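/- Let H be a Hopf superalgebra and H* its linear dual. Let F be a twist for H, and let σ_F be the image of F in (H* ⊗ H*)* under the natural composed embedding H ⊗ H → H** ⊗ H** → (H* ⊗ H*)*. Then σ_F is a 2-cocycle for H*, and there is a canonical isomorphism (H*)_{σ_F} ≅ (H^F)* of Hopf superalgebras. -/

import Mathlib

/-!
Formalization framework for (multiparameter) quantum general linear supergroups,
following Gavarini–Paolini, "Multiparameter Quantum General Linear Supergroup".

We work over `k[[ℏ]] := PowerSeries k` for a field `k` of characteristic zero.
"Super" (ℤ₂-graded) structures are encoded by a family of submodules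
`g : ZMod 2 → Submodule S A` (the homogeneous components), and the Koszul-sign
multiplication on `A ⊗ A` is encoded by a bilinear map `m2` together with its
characterizing property on homogeneous pure tensors (`IsSuperMul`).
"Topological" notions (ℏ-adic or I-adic completeness, topological generation,
topological bases) are rendered through the corresponding adic filtrations.
-/

open scoped TensorProduct
open Finset

noncomputable section

namespace QGLS

/-- The sign `(−1)^a` for a parity `a : ZMod 2`. -/
def sg (S : Type) [Ring S] (a : ZMod 2) : S := if a = 0 then 1 else -1

/-- `p_{i,j} := p(i) + p(j)`. -/
def pp (p : ℕ → ZMod 2) (i j : ℕ) : ZMod 2 := p i + p j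

section Generic

variable (S : Type) [CommRing S]

section Alg
variable (A : Type) [Ring A] [Algebra S A]

/-- A ℤ₂-grading (super-structure) on an `S`-algebra `A`, by submodules. -/
structure SuperGrading (g : ZMod 2 → Submodule S A) : Prop where
  one_mem : (1 : A) ∈ g 0
  mul_mem : ∀ {i j : ZMod 2} {x y : A}, x ∈ g i → y ∈ g j → x * y ∈ g (i + j)
  sup_eq : g 0 ⊔ g 1 = ⊤
  inf_eq : g 0 ⊓ g 1 = ⊥

/-- `m2` is the Koszul-signed ("super") multiplication on `A ⊗[S] A`:
`(a ⊗ b)(c ⊗ d) = (−1)^{|b||c|} (ac ⊗ bd)` on homogeneous elements. -/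
def IsSuperMul (g : ZMod 2 → Submodule S A)
    (m2 : (A ⊗[S] A) →ₗ[S] (A ⊗[S] A) →ₗ[S] (A ⊗[S] A)) : Prop :=
  ∀ (pb pc : ZMod 2) (a b c d : A), b ∈ g pb → c ∈ g pc →
    m2 (a ⊗ₜ[S] b) (c ⊗ₜ[S] d) = sg S (pb * pc) • ((a * c) ⊗ₜ[S] (b * d))

/-- The axioms of a (ℤ₂-graded) superbialgebra over `S`, with coproduct `cop`
and counit `cou`; `m2` is the super multiplication of `A ⊗ A`. -/
structure IsSuperBialg (g : ZMod 2 → Submodule S A)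
    (m2 : (A ⊗[S] A) →ₗ[S] (A ⊗[S] A) →ₗ[S] (A ⊗[S] A))
    (cop : A →ₗ[S] A ⊗[S] A) (cou : A →ₗ[S] S) : Prop where
  grading : SuperGrading S A g
  superMul : IsSuperMul S A g m2
  comul_one : cop 1 = (1 : A) ⊗ₜ[S] (1 : A)
  comul_mul : ∀ x y : A, cop (x * y) = m2 (cop x) (cop y)
  counit_one : cou 1 = 1
  counit_mul : ∀ x y : A, cou (x * y) = cou x * cou y
  coassoc : ∀ x : A,
    (TensorProduct.assoc S A A A)
        ((TensorProduct.map cop (LinearMap.id : A →ₗ[S] A)) (cop x))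
      = (TensorProduct.map (LinearMap.id : A →ₗ[S] A) cop) (cop x)
  counit_comul : ∀ x : A,
    (TensorProduct.lid S A) ((TensorProduct.map cou (LinearMap.id : A →ₗ[S] A)) (cop x)) = x
  comul_counit : ∀ x : A,
    (TensorProduct.rid S A) ((TensorProduct.map (LinearMap.id : A →ₗ[S] A) cou) (cop x)) = x
  comul_parity : ∀ i : ZMod 2, ∀ x ∈ g i, cop x ∈
    Submodule.span S {t : A ⊗[S] A | ∃ j : ZMod 2, ∃ y ∈ g j, ∃ z ∈ g (i + j), t = y ⊗ₜ[S] z}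
  counit_odd : ∀ x ∈ g 1, cou x = 0

/-- `St` is an antipode for the superbialgebra `(A, cop, cou)`. -/
def IsAntipode (cop : A →ₗ[S] A ⊗[S] A) (cou : A →ₗ[S] S) (St : A →ₗ[S] A) : Prop :=
  (∀ x : A, (LinearMap.mul' S A)
      ((TensorProduct.map St (LinearMap.id : A →ₗ[S] A)) (cop x)) = algebraMap S A (cou x)) ∧
  (∀ x : A, (LinearMap.mul' S A)
      ((TensorProduct.map (LinearMap.id : A →ₗ[S] A) St) (cop x)) = algebraMap S A (cou x))

/-- The two-sided ideal generated by a set `T`, as a submodule. -/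
def tsi (T : Set A) : Submodule S A :=
  Submodule.span S {x : A | ∃ a b : A, ∃ s ∈ T, x = a * s * b}

/-- `A` is topologically generated by `T` with respect to the filtration `Fl`. -/
def TopGenBy (Fl : ℕ → Submodule S A) (T : Set A) : Prop :=
  ∀ a : A, ∀ N : ℕ, ∃ b ∈ Algebra.adjoin S T, a - b ∈ Fl N

end Alg

section Mod
variable (M : Type) [AddCommGroup M] [Module S M]

/-- The `r`-adic filtration on a module. -/
def adicFil (r : S) (N : ℕ) : Submodule S M :=
  Submodule.span S {x : M | ∃ y : M, x = r ^ N • y}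

/-- Separatedness and completeness with respect to a filtration of submodules. -/
def CompleteWRT (Fl : ℕ → Submodule S M) : Prop :=
  (∀ x : M, (∀ N, x ∈ Fl N) → x = 0) ∧
  (∀ f : ℕ → M, (∀ N, f (N + 1) - f N ∈ Fl N) → ∃ x : M, ∀ N, x - f N ∈ Fl N)

/-- A representation of a tensor `t ∈ M ⊗ M` as a finite sum of pure tensors
with homogeneous factors (of the prescribed parities). -/
def Rep (g : ZMod 2 → Submodule S M) (t : M ⊗[S] M) (ι : Type) (s : Finset ι)
    (a b : ι → M) (pa pb : ι → ZMod 2) : Prop :=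
  t = ∑ i ∈ s, a i ⊗ₜ[S] b i ∧ ∀ i ∈ s, a i ∈ g (pa i) ∧ b i ∈ g (pb i)

/-- A homogeneous representation of the double coproduct `(Δ ⊗ id)(Δ x)`. -/
def Rep3 (g : ZMod 2 → Submodule S M) (cop : M →ₗ[S] M ⊗[S] M) (x : M) (ι : Type)
    (s : Finset ι) (a b c : ι → M) (pa pb pc : ι → ZMod 2) : Prop :=
  ((TensorProduct.map cop (LinearMap.id : M →ₗ[S] M)) (cop x)
      = ∑ i ∈ s, (a i ⊗ₜ[S] b i) ⊗ₜ[S] c i) ∧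
  ∀ i ∈ s, a i ∈ g (pa i) ∧ b i ∈ g (pb i) ∧ c i ∈ g (pc i)

/-- `σ'` is a convolution inverse of the bilinear form `σ` (with Koszul signs). -/
def ConvInverse (g : ZMod 2 → Submodule S M) (cop : M →ₗ[S] M ⊗[S] M) (cou : M →ₗ[S] S)
    (σ σ' : M →ₗ[S] M →ₗ[S] S) : Prop :=
  ∀ x y : M, ∀ (ι : Type) (s : Finset ι) (a b : ι → M) (pa pb : ι → ZMod 2),
    Rep S M g (cop x) ι s a b pa pb →
    ∀ (ι' : Type) (s' : Finset ι') (c d : ι' → M) (pc pd : ι' → ZMod 2),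
      Rep S M g (cop y) ι' s' c d pc pd →
    (∑ i ∈ s, ∑ j ∈ s', sg S (pb i * pc j) * (σ (a i) (c j) * σ' (b i) (d j))
        = cou x * cou y) ∧
    (∑ i ∈ s, ∑ j ∈ s', sg S (pb i * pc j) * (σ' (a i) (c j) * σ (b i) (d j))
        = cou x * cou y)

/-- `σ` is a (normalized, convolution-invertible) 2-cocycle for the
super-coalgebra-with-multiplication `(M, mul, one, cop, cou)`;
the Sweedler-type identities are expressed through homogeneous representations
of the coproducts (with Koszul signs). -/
structure Is2Cocycle (g : ZMod 2 → Submodule S M) (mul : M → M → M) (one : M)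
    (cop : M →ₗ[S] M ⊗[S] M) (cou : M →ₗ[S] S) (σ : M →ₗ[S] M →ₗ[S] S) : Prop where
  norm_right : ∀ x : M, σ x one = cou x
  norm_left : ∀ x : M, σ one x = cou x
  conv_inv : ∃ σ' : M →ₗ[S] M →ₗ[S] S, ConvInverse S M g cop cou σ σ'
  cocycle : ∀ x y z : M,
    ∀ (ι : Type) (s : Finset ι) (a b : ι → M) (pa pb : ι → ZMod 2),
      Rep S M g (cop x) ι s a b pa pb →
    ∀ (ι' : Type) (s' : Finset ι') (c d : ι' → M) (pc pd : ι' → ZMod 2),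
      Rep S M g (cop y) ι' s' c d pc pd →
    ∀ (ι'' : Type) (s'' : Finset ι'') (u v : ι'' → M) (pu pv : ι'' → ZMod 2),
      Rep S M g (cop z) ι'' s'' u v pu pv →
    ∑ i ∈ s, ∑ j ∈ s', sg S (pb i * pc j) * (σ (a i) (c j) * σ (mul (b i) (d j)) z)
      = ∑ j ∈ s', ∑ l ∈ s'', sg S (pd j * pu l) * (σ (c j) (u l) * σ x (mul (d j) (v l)))

/-- `mulσ` is the 2-cocycle deformation of the product `mul` by the 2-cocycle `σ`
(with convolution inverse `σ'`):  `x ·σ y = σ(x₁,y₁) x₂y₂ σ'(x₃,y₃)`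
(with Koszul signs), expressed through homogeneous representations. -/
def IsCocycleDeform (g : ZMod 2 → Submodule S M) (mul : M → M → M)
    (cop : M →ₗ[S] M ⊗[S] M) (σ σ' : M →ₗ[S] M →ₗ[S] S) (mulσ : M → M → M) : Prop :=
  ∀ x y : M,
    ∀ (ι : Type) (s : Finset ι) (a b c : ι → M) (pa pb pc : ι → ZMod 2),
      Rep3 S M g cop x ι s a b c pa pb pc →
    ∀ (ι' : Type) (s' : Finset ι') (d e f : ι' → M) (pd pe pf : ι' → ZMod 2),
      Rep3 S M g cop y ι' s' d e f pd pe pf →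
    mulσ x y = ∑ i ∈ s, ∑ j ∈ s',
      (sg S (pd j * (pb i + pc i) + pe j * pc i) * (σ (a i) (d j) * σ' (c i) (f j)))
        • mul (b i) (e j)

/-- Iterated powers with respect to a bilinear multiplication map. -/
def spow (m2 : M →ₗ[S] M →ₗ[S] M) (one : M) (z : M) : ℕ → M
  | 0 => one
  | (m + 1) => m2 z (spow m2 one z m)

end Mod

section Pairing
variable (Fc : Type) [Ring Fc] [Algebra S Fc] (Uc : Type) [Ring Uc] [Algebra S Uc]

/-- `B2` extends the pairing `B` to tensor squares with the Koszul sign rule: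
`⟨f₁ ⊗ f₂ , u₁ ⊗ u₂⟩ = (−1)^{|f₂||u₁|} ⟨f₁,u₁⟩⟨f₂,u₂⟩`. -/
def IsPairing2 (gF : ZMod 2 → Submodule S Fc) (gU : ZMod 2 → Submodule S Uc)
    (B : Fc →ₗ[S] Uc →ₗ[S] S)
    (B2 : (Fc ⊗[S] Fc) →ₗ[S] (Uc ⊗[S] Uc) →ₗ[S] S) : Prop :=
  ∀ (pf pu : ZMod 2) (f1 f2 : Fc) (u1 u2 : Uc), f2 ∈ gF pf → u1 ∈ gU pu →
    B2 (f1 ⊗ₜ[S] f2) (u1 ⊗ₜ[S] u2) = sg S (pf * pu) * (B f1 u1 * B f2 u2)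

/-- A pairing of superbialgebras: product on one side is dual to coproduct on
the other (with Koszul signs), and units/counits correspond. -/
structure IsBialgPairing (gF : ZMod 2 → Submodule S Fc) (gU : ZMod 2 → Submodule S Uc)
    (copF : Fc →ₗ[S] Fc ⊗[S] Fc) (couF : Fc →ₗ[S] S)
    (copU : Uc →ₗ[S] Uc ⊗[S] Uc) (couU : Uc →ₗ[S] S)
    (B : Fc →ₗ[S] Uc →ₗ[S] S)
    (B2 : (Fc ⊗[S] Fc) →ₗ[S] (Uc ⊗[S] Uc) →ₗ[S] S) : Prop where
  pair2 : IsPairing2 S Fc Uc gF gU B B2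
  mulU : ∀ (f : Fc) (u u' : Uc), B f (u * u') = B2 (copF f) (u ⊗ₜ[S] u')
  mulF : ∀ (f f' : Fc) (u : Uc), B (f * f') u = B2 (f ⊗ₜ[S] f') (copU u)
  oneU : ∀ f : Fc, B f 1 = couF f
  oneF : ∀ u : Uc, B 1 u = couU u

/-- Non-degeneracy of a pairing. -/
def Nondeg (B : Fc →ₗ[S] Uc →ₗ[S] S) : Prop :=
  (∀ f : Fc, (∀ u : Uc, B f u = 0) → f = 0) ∧
  (∀ u : Uc, (∀ f : Fc, B f u = 0) → u = 0)

end Pairing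

end Generic

/-! ## Abstract Hopf superalgebras, twists, 2-cocycles, and linear duality

Here a Hopf superalgebra over a field `k` is encoded in "bare" form: the
multiplication is a bilinear map `mul` (so that deformed products on the same
underlying space can be compared), `one` is the unit, `g` is the ℤ₂-grading,
`m2` is the Koszul-signed multiplication of `A ⊗ A`, and `cop`, `cou`, `ant`
are the coproduct, counit and antipode. -/

section Abstract

variable (k : Type) [Field k]
variable (A : Type) [AddCommGroup A] [Module k A]

/-- `m2` is the Koszul-signed multiplication on `A ⊗ A` induced by `mul`. -/
def IsSMul (g : ZMod 2 → Submodule k A) (mul : A →ₗ[k] A →ₗ[k] A)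
    (m2 : (A ⊗[k] A) →ₗ[k] (A ⊗[k] A) →ₗ[k] (A ⊗[k] A)) : Prop :=
  ∀ (pb pc : ZMod 2) (a b c d : A), b ∈ g pb → c ∈ g pc →
    m2 (a ⊗ₜ[k] b) (c ⊗ₜ[k] d) = sg k (pb * pc) • (mul a c ⊗ₜ[k] mul b d)

/-- `m3` is the Koszul-signed multiplication on `(A ⊗ A) ⊗ A` induced by `mul`:
`(a⊗b⊗c)(d⊗e⊗f) = (−1)^{|b||d|+|c||d|+|c||e|} (ad ⊗ be ⊗ cf)`. -/
def IsSMul3 (g : ZMod 2 → Submodule k A) (mul : A →ₗ[k] A →ₗ[k] A)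
    (m3 : ((A ⊗[k] A) ⊗[k] A) →ₗ[k] ((A ⊗[k] A) ⊗[k] A) →ₗ[k] ((A ⊗[k] A) ⊗[k] A)) :
    Prop :=
  ∀ (pb pc pd pe : ZMod 2) (a b c d e f : A),
    b ∈ g pb → c ∈ g pc → d ∈ g pd → e ∈ g pe →
    m3 ((a ⊗ₜ[k] b) ⊗ₜ[k] c) ((d ⊗ₜ[k] e) ⊗ₜ[k] f)
      = sg k (pb * pd + pc * pd + pc * pe) • ((mul a d ⊗ₜ[k] mul b e) ⊗ₜ[k] mul c f)

/-- The axioms of a Hopf superalgebra over `k`, in bare (unbundled) form. -/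
structure IsHopfSData (mul : A →ₗ[k] A →ₗ[k] A) (one : A) (g : ZMod 2 → Submodule k A)
    (m2 : (A ⊗[k] A) →ₗ[k] (A ⊗[k] A) →ₗ[k] (A ⊗[k] A))
    (cop : A →ₗ[k] A ⊗[k] A) (cou : A →ₗ[k] k) (ant : A →ₗ[k] A) : Prop where
  mul_assoc : ∀ x y z : A, mul (mul x y) z = mul x (mul y z)
  one_mul : ∀ x : A, mul one x = x
  mul_one : ∀ x : A, mul x one = x
  one_mem : one ∈ g 0
  mul_mem : ∀ {i j : ZMod 2} {x y : A}, x ∈ g i → y ∈ g j → mul x y ∈ g (i + j)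
  sup_eq : g 0 ⊔ g 1 = ⊤
  inf_eq : g 0 ⊓ g 1 = ⊥
  smul2 : IsSMul k A g mul m2
  comul_one : cop one = one ⊗ₜ[k] one
  comul_mul : ∀ x y : A, cop (mul x y) = m2 (cop x) (cop y)
  counit_one : cou one = 1
  counit_mul : ∀ x y : A, cou (mul x y) = cou x * cou y
  coassoc : ∀ x : A,
    (TensorProduct.assoc k A A A)
        ((TensorProduct.map cop (LinearMap.id : A →ₗ[k] A)) (cop x))
      = (TensorProduct.map (LinearMap.id : A →ₗ[k] A) cop) (cop x)
  counit_comul : ∀ x : A,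
    (TensorProduct.lid k A) ((TensorProduct.map cou (LinearMap.id : A →ₗ[k] A)) (cop x)) = x
  comul_counit : ∀ x : A,
    (TensorProduct.rid k A) ((TensorProduct.map (LinearMap.id : A →ₗ[k] A) cou) (cop x)) = x
  antipode_left : ∀ x : A,
    (TensorProduct.lift mul) ((TensorProduct.map ant (LinearMap.id : A →ₗ[k] A)) (cop x))
      = cou x • one
  antipode_right : ∀ x : A,
    (TensorProduct.lift mul) ((TensorProduct.map (LinearMap.id : A →ₗ[k] A) ant) (cop x))
      = cou x • one
  comul_parity : ∀ i : ZMod 2, ∀ x ∈ g i, cop x ∈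
    Submodule.span k {t : A ⊗[k] A | ∃ j : ZMod 2, ∃ y ∈ g j, ∃ z ∈ g (i + j), t = y ⊗ₜ[k] z}
  counit_odd : ∀ x ∈ g 1, cou x = 0

/-- `f` is a twist for the Hopf superalgebra `(A, mul, one, g, m2, cop, cou)`,
with inverse `fi`:  it is invertible, counital, and satisfies the twist equation
`(F ⊗ 1)·(Δ ⊗ id)(F) = (1 ⊗ F)·(id ⊗ Δ)(F)` in `A ⊗ A ⊗ A` (products being
taken with the Koszul-signed multiplication `m3`). -/
def IsTwist (mul : A →ₗ[k] A →ₗ[k] A) (one : A) (g : ZMod 2 → Submodule k A)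
    (m2 : (A ⊗[k] A) →ₗ[k] (A ⊗[k] A) →ₗ[k] (A ⊗[k] A))
    (cop : A →ₗ[k] A ⊗[k] A) (cou : A →ₗ[k] k) (f fi : A ⊗[k] A) : Prop :=
  m2 f fi = one ⊗ₜ[k] one ∧ m2 fi f = one ⊗ₜ[k] one ∧
  (TensorProduct.lid k A) ((TensorProduct.map cou (LinearMap.id : A →ₗ[k] A)) f) = one ∧
  (TensorProduct.rid k A) ((TensorProduct.map (LinearMap.id : A →ₗ[k] A) cou) f) = one ∧
  ∀ m3 : ((A ⊗[k] A) ⊗[k] A) →ₗ[k] ((A ⊗[k] A) ⊗[k] A) →ₗ[k] ((A ⊗[k] A) ⊗[k] A),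
    IsSMul3 k A g mul m3 →
    m3 (f ⊗ₜ[k] one) ((TensorProduct.map cop (LinearMap.id : A →ₗ[k] A)) f)
      = m3 ((TensorProduct.assoc k A A A).symm (one ⊗ₜ[k] f))
          ((TensorProduct.assoc k A A A).symm
            ((TensorProduct.map (LinearMap.id : A →ₗ[k] A) cop) f))

/-- The grading of the linear dual: a functional is homogeneous of parity `i`
iff it kills the component of parity `i + 1`. -/
def dualGrading (g : ZMod 2 → Submodule k A) (i : ZMod 2) :
    Submodule k (Module.Dual k A) where
  carrier := {φ | ∀ x ∈ g (i + 1), φ x = 0}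
  add_mem' := by
    intro φ ψ hφ hψ x hx
    simp [hφ x hx, hψ x hx]
  zero_mem' := by intro x hx; simp
  smul_mem' := by
    intro c φ hφ x hx
    simp [hφ x hx]

/-- `B2` is the Koszul-signed evaluation pairing of `H^* ⊗ H^*` against
`H ⊗ H`:  `⟨φ ⊗ ψ, x ⊗ y⟩ = (−1)^{|ψ||x|} φ(x) ψ(y)`. -/
def IsDualPair2 (g : ZMod 2 → Submodule k A)
    (B2 : (Module.Dual k A ⊗[k] Module.Dual k A) →ₗ[k] (A ⊗[k] A) →ₗ[k] k) : Prop :=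
  ∀ (pψ px : ZMod 2) (φ ψ : Module.Dual k A) (x y : A),
    ψ ∈ dualGrading k A g pψ → x ∈ g px →
    B2 (φ ⊗ₜ[k] ψ) (x ⊗ₜ[k] y) = sg k (pψ * px) * (φ x * ψ y)

/-- The data `(mulD, oneD, gD, copD, couD, antD)` on `H^* = Module.Dual k A`
is the dual Hopf superalgebra structure of `(mul, one, g, cop, cou, ant)`:
the product of `H^*` is dual to the coproduct of `H` (with Koszul signs), etc. -/
structure IsDualHopfOf (mul : A → A → A) (one : A) (g : ZMod 2 → Submodule k A)
    (cop : A →ₗ[k] A ⊗[k] A) (cou : A →ₗ[k] k) (ant : A →ₗ[k] A)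
    (mulD : Module.Dual k A → Module.Dual k A → Module.Dual k A)
    (oneD : Module.Dual k A) (gD : ZMod 2 → Submodule k (Module.Dual k A))
    (copD : Module.Dual k A →ₗ[k] Module.Dual k A ⊗[k] Module.Dual k A)
    (couD : Module.Dual k A →ₗ[k] k)
    (antD : Module.Dual k A →ₗ[k] Module.Dual k A) : Prop where
  grading_eq : gD = dualGrading k A g
  one_eq : oneD = cou
  mul_eq : ∀ B2, IsDualPair2 k A g B2 →
    ∀ (φ ψ : Module.Dual k A) (x : A), mulD φ ψ x = B2 (φ ⊗ₜ[k] ψ) (cop x)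
  comul_eq : ∀ B2, IsDualPair2 k A g B2 →
    ∀ (φ : Module.Dual k A) (x y : A), B2 (copD φ) (x ⊗ₜ[k] y) = φ (mul x y)
  counit_eq : ∀ φ : Module.Dual k A, couD φ = φ one
  antipode_eq : ∀ (φ : Module.Dual k A) (x : A), antD φ x = φ (ant x)

end Abstract

end QGLS

namespace QGLS

section Signs

variable {k : Type} [Field k]

lemma parity_cases (i : ZMod 2) : i = 0 ∨ i = 1 := by
  revert i; decide

lemma sg_zero : sg k 0 = 1 := by simp [sg]

lemma sg_mul_sg (a b : ZMod 2) : sg k a * sg k b = sg k (a + b) := by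
  rcases parity_cases a with rfl | rfl <;> rcases parity_cases b with rfl | rfl <;>
    simp [sg, CharTwo.add_self_eq_zero]

lemma sg_mul_sg_assoc (a b : ZMod 2) (c : k) : sg k a * (sg k b * c) = sg k (a + b) * c := by
  rw [← mul_assoc, sg_mul_sg]

lemma sg_self_mul (a : ZMod 2) : sg k a * sg k a = 1 := by
  rw [sg_mul_sg, CharTwo.add_self_eq_zero, sg_zero]

lemma sg_eq_one_of_two_eq_zero (h : (2 : k) = 0) (a : ZMod 2) : sg k a = 1 := by
  unfold sg
  split_ifs
  · rfl
  · linear_combination -h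

end Signs

section Homogeneous

variable {k : Type} [Field k] {A : Type} [AddCommGroup A] [Module k A]
variable {g : ZMod 2 → Submodule k A}

/-- Induction on homogeneous elements. -/
lemma homogeneous_induction (hsup : g 0 ⊔ g 1 = ⊤) {P : A → Prop}
    (hom : ∀ i, ∀ a ∈ g i, P a) (add : ∀ a b, P a → P b → P (a + b)) (a : A) : P a := by
  have ha : a ∈ g 0 ⊔ g 1 := by rw [hsup]; trivial
  obtain ⟨y, hy, z, hz, rfl⟩ := Submodule.mem_sup.1 ha
  exact add _ _ (hom _ _ hy) (hom _ _ hz)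

/-- Induction on tensors of two homogeneous elements. -/
lemma homogeneous_induction₂ (hsup : g 0 ⊔ g 1 = ⊤) {P : A ⊗[k] A → Prop}
    (hom : ∀ i j, ∀ a ∈ g i, ∀ b ∈ g j, P (a ⊗ₜ b)) (add : ∀ s t, P s → P t → P (s + t))
    (t : A ⊗[k] A) : P t := by
  induction t with
  | zero => simpa using hom 0 0 0 (zero_mem _) 0 (zero_mem _)
  | add s t hs ht => exact add s t hs ht
  | tmul a b =>
    refine homogeneous_induction hsup (P := fun a => P (a ⊗ₜ b)) (fun i a ha => ?_) ?_ a
    · refine homogeneous_induction hsup (P := fun b => P (a ⊗ₜ b)) (fun j b hb => ?_) ?_ b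
      · exact hom i j a ha b hb
      · intro b c hb hc
        simpa only [TensorProduct.tmul_add] using add _ _ hb hc
    · intro b c hb hc
      simpa only [TensorProduct.add_tmul] using add _ _ hb hc

/-- Induction on tensors of three homogeneous elements. -/
lemma homogeneous_induction₃ (hsup : g 0 ⊔ g 1 = ⊤) {P : (A ⊗[k] A) ⊗[k] A → Prop}
    (hom : ∀ i j l, ∀ a ∈ g i, ∀ b ∈ g j, ∀ c ∈ g l, P ((a ⊗ₜ b) ⊗ₜ c))
    (add : ∀ s t, P s → P t → P (s + t)) (t : (A ⊗[k] A) ⊗[k] A) : P t := by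
  induction t with
  | zero =>
    simpa using hom 0 0 0 0 (zero_mem _) 0 (zero_mem _) 0 (zero_mem _)
  | add s t hs ht => exact add s t hs ht
  | tmul t c =>
    refine homogeneous_induction₂ hsup (P := fun t => P (t ⊗ₜ c)) (fun i j a ha b hb => ?_) ?_ t
    · refine homogeneous_induction hsup (P := fun c => P ((a ⊗ₜ b) ⊗ₜ c)) (fun l c hc => ?_) ?_ c
      · exact hom i j l a ha b hb c hc
      · intro b c hb hc
        simpa only [TensorProduct.tmul_add] using add _ _ hb hc
    · intro b c hb hc
      simpa only [TensorProduct.add_tmul] using add _ _ hb hc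

/-- `P` is the projection onto the odd part. -/
def IsOddPart (g : ZMod 2 → Submodule k A) (P : A →ₗ[k] A) : Prop :=
  ∀ i, ∀ x ∈ g i, P x = if i = 0 then 0 else x

lemma exists_isOddPart (hsup : g 0 ⊔ g 1 = ⊤) (hinf : g 0 ⊓ g 1 = ⊥) :
    ∃ P : A →ₗ[k] A, IsOddPart g P := by
  have h : IsCompl (g 1) (g 0) :=
    ⟨disjoint_iff.2 (by rw [inf_comm, hinf]), codisjoint_iff.2 (by rw [sup_comm, hsup])⟩
  refine ⟨(g 1).projection (g 0) h, fun i x hx => ?_⟩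
  rcases parity_cases i with rfl | rfl
  · simpa using hx
  · simpa using hx

/-- Tensors of even total parity; all tensors in characteristic two, where parity is
irrelevant. -/
def evenTensors (g : ZMod 2 → Submodule k A) : Submodule k (A ⊗[k] A) :=
  Submodule.span k {t | ∃ i j, ∃ a ∈ g i, ∃ b ∈ g j, (i = j ∨ ∀ c, sg k c = 1) ∧ t = a ⊗ₜ b}

/-- The odd part of a tensor. -/
def oddPart₂ (P : A →ₗ[k] A) : A ⊗[k] A →ₗ[k] A ⊗[k] A :=
  TensorProduct.map P LinearMap.id + TensorProduct.map LinearMap.id P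
    - (2 : k) • TensorProduct.map P P

lemma oddPart₂_tmul {P : A →ₗ[k] A} (hP : IsOddPart g P) {i j : ZMod 2} {a b : A}
    (ha : a ∈ g i) (hb : b ∈ g j) :
    oddPart₂ P (a ⊗ₜ b) = if i = j then 0 else a ⊗ₜ[k] b := by
  simp only [oddPart₂, LinearMap.sub_apply, LinearMap.add_apply, LinearMap.smul_apply,
    TensorProduct.map_tmul, LinearMap.id_apply, hP i a ha, hP j b hb]
  rcases parity_cases i with rfl | rfl <;> rcases parity_cases j with rfl | rfl <;>
    simp [two_smul]

lemma sub_oddPart₂_mem_evenTensors (hsup : g 0 ⊔ g 1 = ⊤) {P : A →ₗ[k] A} (hP : IsOddPart g P)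
    (t : A ⊗[k] A) : t - oddPart₂ P t ∈ evenTensors g := by
  refine homogeneous_induction₂ hsup (P := fun t => t - oddPart₂ P t ∈ evenTensors g)
    (fun i j a ha b hb => ?_) (fun s t hs ht => ?_) t
  · rw [oddPart₂_tmul hP ha hb]
    split_ifs with hij
    · rw [sub_zero]
      exact Submodule.subset_span ⟨i, j, a, ha, b, hb, Or.inl hij, rfl⟩
    · simp
  · rw [map_add, add_sub_add_comm]
    exact add_mem hs ht

lemma mem_evenTensors (hsup : g 0 ⊔ g 1 = ⊤) {P : A →ₗ[k] A} (hP : IsOddPart g P)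
    {t : A ⊗[k] A} (ht : (2 : k) = 0 ∨ oddPart₂ P t = 0) : t ∈ evenTensors g := by
  rcases ht with h | h
  · refine homogeneous_induction₂ hsup (P := fun t => t ∈ evenTensors g)
      (fun i j a ha b hb => ?_) (fun s t hs ht => add_mem hs ht) t
    exact Submodule.subset_span ⟨i, j, a, ha, b, hb, Or.inr (sg_eq_one_of_two_eq_zero h), rfl⟩
  · simpa [h] using sub_oddPart₂_mem_evenTensors hsup hP t

end Homogeneous

section Convolution

variable {k : Type} [Field k] {A : Type} [AddCommGroup A] [Module k A]
variable {E : Type} [Ring E] [Algebra k E]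

/-- The map `x ⊗ y ↦ u x * v y`. -/
def mulMap {M N : Type} [AddCommGroup M] [Module k M] [AddCommGroup N] [Module k N]
    (u : M →ₗ[k] E) (v : N →ₗ[k] E) : M ⊗[k] N →ₗ[k] E :=
  TensorProduct.lift ((LinearMap.mul k E).compl₁₂ u v)

@[simp] lemma mulMap_tmul {M N : Type} [AddCommGroup M] [Module k M] [AddCommGroup N]
    [Module k N] (u : M →ₗ[k] E) (v : N →ₗ[k] E) (x : M) (y : N) :
    mulMap u v (x ⊗ₜ y) = u x * v y := rfl

/-- A unital multiplicative linear map. -/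
structure IsAlgMap (mul : A →ₗ[k] A →ₗ[k] A) (one : A) (u : A →ₗ[k] E) : Prop where
  map_one : u one = 1
  map_mul : ∀ a b, u (mul a b) = u a * u b

/-- The images of `u` and `v` commute up to the Koszul sign. -/
def SuperCommute (g : ZMod 2 → Submodule k A) (u v : A →ₗ[k] E) : Prop :=
  ∀ i j, ∀ a ∈ g i, ∀ b ∈ g j, v b * u a = sg k (i * j) • (u a * v b)

variable {mul : A →ₗ[k] A →ₗ[k] A} {one : A} {g : ZMod 2 → Submodule k A}
  {m2 : (A ⊗[k] A) →ₗ[k] (A ⊗[k] A) →ₗ[k] (A ⊗[k] A)}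
  {cop : A →ₗ[k] A ⊗[k] A} {cou : A →ₗ[k] k} {ant : A →ₗ[k] A}
  {u v w : A →ₗ[k] E}

lemma SuperCommute.mul_assoc_left (h : SuperCommute g u v) {i j : ZMod 2} {a b : A}
    (ha : a ∈ g i) (hb : b ∈ g j) (e : E) :
    v b * (u a * e) = sg k (i * j) • (u a * (v b * e)) := by
  rw [← mul_assoc, h i j a ha b hb, smul_mul_assoc, mul_assoc]

lemma mulMap_mul (hsup : g 0 ⊔ g 1 = ⊤) (hm2 : IsSMul k A g mul m2)
    (hu : IsAlgMap mul one u) (hv : IsAlgMap mul one v) (huv : SuperCommute g u v)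
    (s t : A ⊗[k] A) : mulMap u v (m2 s t) = mulMap u v s * mulMap u v t := by
  refine homogeneous_induction₂ hsup
    (P := fun s => mulMap u v (m2 s t) = mulMap u v s * mulMap u v t)
    (fun i j a ha b hb => ?_) (fun s t hs ht => ?_) s
  · refine homogeneous_induction₂ hsup
      (P := fun t => mulMap u v (m2 (a ⊗ₜ b) t) = mulMap u v (a ⊗ₜ b) * mulMap u v t)
      (fun l m c hc d hd => ?_) (fun s t hs ht => ?_) t
    · rw [hm2 j l a b c d hb hc]
      simp only [map_smul, mulMap_tmul, hu.map_mul, hv.map_mul, mul_assoc,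
        huv.mul_assoc_left hc hb, mul_smul_comm, mul_comm j l]
    · simp only [map_add, mul_add, hs, ht]
  · simp only [map_add, LinearMap.add_apply, add_mul, hs, ht]

lemma mulMap₃_mul (hsup : g 0 ⊔ g 1 = ⊤)
    {m3 : ((A ⊗[k] A) ⊗[k] A) →ₗ[k] ((A ⊗[k] A) ⊗[k] A) →ₗ[k] ((A ⊗[k] A) ⊗[k] A)}
    (hm3 : IsSMul3 k A g mul m3)
    (hu : IsAlgMap mul one u) (hv : IsAlgMap mul one v) (hw : IsAlgMap mul one w)
    (huv : SuperCommute g u v) (huw : SuperCommute g u w) (hvw : SuperCommute g v w)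
    (s t : (A ⊗[k] A) ⊗[k] A) :
    mulMap (mulMap u v) w (m3 s t) = mulMap (mulMap u v) w s * mulMap (mulMap u v) w t := by
  refine homogeneous_induction₃ hsup
    (P := fun s => mulMap (mulMap u v) w (m3 s t)
      = mulMap (mulMap u v) w s * mulMap (mulMap u v) w t)
    (fun i j l a ha b hb c hc => ?_) (fun s t hs ht => ?_) s
  · refine homogeneous_induction₃ hsup
      (P := fun t => mulMap (mulMap u v) w (m3 ((a ⊗ₜ b) ⊗ₜ c) t)
        = mulMap (mulMap u v) w ((a ⊗ₜ b) ⊗ₜ c) * mulMap (mulMap u v) w t)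
      (fun i' j' l' a' ha' b' hb' c' hc' => ?_) (fun s t hs ht => ?_) t
    · rw [hm3 j l i' j' a b c a' b' c' hb hc ha' hb']
      simp only [map_smul, mulMap_tmul, hu.map_mul, hv.map_mul, hw.map_mul, mul_assoc,
        huv.mul_assoc_left ha' hb, huw.mul_assoc_left ha' hc, hvw.mul_assoc_left hb' hc,
        mul_smul_comm, smul_smul, sg_mul_sg]
      congr 2
      ring
    · simp only [map_add, mul_add, hs, ht]
  · simp only [map_add, LinearMap.add_apply, add_mul, hs, ht]

lemma IsAlgMap.mulMap_comp_cop (hH : IsHopfSData k A mul one g m2 cop cou ant)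
    (hu : IsAlgMap mul one u) (hv : IsAlgMap mul one v) (huv : SuperCommute g u v) :
    IsAlgMap mul one (mulMap u v ∘ₗ cop) where
  map_one := by simp [hH.comul_one, hu.map_one, hv.map_one]
  map_mul a b := by
    simp only [LinearMap.comp_apply, hH.comul_mul, mulMap_mul hH.sup_eq hH.smul2 hu hv huv]

lemma SuperCommute.mulMap_comp_cop_left (hH : IsHopfSData k A mul one g m2 cop cou ant)
    (huw : SuperCommute g u w) (hvw : SuperCommute g v w) :
    SuperCommute g (mulMap u v ∘ₗ cop) w := by
  intro i j a ha b hb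
  rw [LinearMap.comp_apply]
  refine Submodule.span_induction
    (p := fun t _ => w b * mulMap u v t = sg k (i * j) • (mulMap u v t * w b))
    ?_ ?_ ?_ ?_ (hH.comul_parity i a ha)
  · rintro _ ⟨l, y, hy, z, hz, rfl⟩
    simp only [mulMap_tmul, huw.mul_assoc_left hy hb, hvw _ _ z hz b hb, mul_assoc,
      mul_smul_comm, smul_smul, sg_mul_sg]
    congr 2
    linear_combination l * j * (CharTwo.two_eq_zero (R := ZMod 2))
  · simp
  · intro s t _ _ hs ht
    simp only [map_add, mul_add, add_mul, hs, ht, smul_add]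
  · intro c t _ ht
    simp only [map_smul, mul_smul_comm, smul_mul_assoc, ht, smul_comm c]

lemma SuperCommute.mulMap_comp_cop_right (hH : IsHopfSData k A mul one g m2 cop cou ant)
    (huv : SuperCommute g u v) (huw : SuperCommute g u w) :
    SuperCommute g u (mulMap v w ∘ₗ cop) := by
  intro i j a ha b hb
  rw [LinearMap.comp_apply]
  refine Submodule.span_induction
    (p := fun t _ => mulMap v w t * u a = sg k (i * j) • (u a * mulMap v w t))
    ?_ ?_ ?_ ?_ (hH.comul_parity j b hb)
  · rintro _ ⟨l, y, hy, z, hz, rfl⟩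
    simp only [mulMap_tmul, mul_assoc, huw _ _ a ha z hz, huv.mul_assoc_left ha hy,
      mul_smul_comm, smul_smul, sg_mul_sg]
    congr 2
    linear_combination i * l * (CharTwo.two_eq_zero (R := ZMod 2))
  · simp
  · intro s t _ _ hs ht
    simp only [map_add, mul_add, add_mul, hs, ht, smul_add]
  · intro c t _ ht
    simp only [map_smul, mul_smul_comm, smul_mul_assoc, ht, smul_comm c]

lemma mulMap₃_tmul_one (hw : IsAlgMap mul one w) (t : A ⊗[k] A) :
    mulMap (mulMap u v) w (t ⊗ₜ one) = mulMap u v t := by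
  simp [hw.map_one]

lemma mulMap₃_map_cop_id (t : A ⊗[k] A) :
    mulMap (mulMap u v) w (TensorProduct.map cop LinearMap.id t)
      = mulMap (mulMap u v ∘ₗ cop) w t := by
  induction t with
  | zero => simp
  | add s t hs ht => simp only [map_add, hs, ht]
  | tmul a b => simp

lemma mulMap₃_assoc_symm_tmul (a : A) (t : A ⊗[k] A) :
    mulMap (mulMap u v) w ((TensorProduct.assoc k A A A).symm (a ⊗ₜ t))
      = u a * mulMap v w t := by
  induction t with
  | zero => simp
  | add s t hs ht => simp only [TensorProduct.tmul_add, map_add, mul_add, hs, ht]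
  | tmul a b => simp [mul_assoc]

lemma mulMap₃_assoc_symm_map_id_cop (t : A ⊗[k] A) :
    mulMap (mulMap u v) w
        ((TensorProduct.assoc k A A A).symm (TensorProduct.map LinearMap.id cop t))
      = mulMap u (mulMap v w ∘ₗ cop) t := by
  induction t with
  | zero => simp
  | add s t hs ht => simp only [map_add, hs, ht]
  | tmul a b => simp [mulMap₃_assoc_symm_tmul]

lemma mulMap_comp_cop_assoc (hH : IsHopfSData k A mul one g m2 cop cou ant) :
    mulMap (mulMap u v ∘ₗ cop) w ∘ₗ cop = mulMap u (mulMap v w ∘ₗ cop) ∘ₗ cop := by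
  ext x
  rw [LinearMap.comp_apply, LinearMap.comp_apply, ← mulMap₃_map_cop_id,
    ← mulMap₃_assoc_symm_map_id_cop, ← hH.coassoc, LinearEquiv.symm_apply_apply]

lemma oddPart₂_commutator (hsup : g 0 ⊔ g 1 = ⊤) {P : A →ₗ[k] A} (hP : IsOddPart g P)
    {u₁ u₂ v₁ v₂ : A →ₗ[k] E}
    (h₁₁ : SuperCommute g u₁ v₁) (h₁₂ : SuperCommute g u₁ v₂)
    (h₂₁ : SuperCommute g u₂ v₁) (h₂₂ : SuperCommute g u₂ v₂) (s t : A ⊗[k] A) :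
    mulMap v₁ v₂ t * mulMap u₁ u₂ s = mulMap u₁ u₂ s * mulMap v₁ v₂ t
      - (2 : k) • (mulMap u₁ u₂ (oddPart₂ P s) * mulMap v₁ v₂ (oddPart₂ P t)) := by
  refine homogeneous_induction₂ hsup
    (P := fun s => mulMap v₁ v₂ t * mulMap u₁ u₂ s = mulMap u₁ u₂ s * mulMap v₁ v₂ t
      - (2 : k) • (mulMap u₁ u₂ (oddPart₂ P s) * mulMap v₁ v₂ (oddPart₂ P t)))
    (fun i j a ha b hb => ?_) (fun s t hs ht => ?_) s
  · refine homogeneous_induction₂ hsup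
      (P := fun t => mulMap v₁ v₂ t * mulMap u₁ u₂ (a ⊗ₜ b)
        = mulMap u₁ u₂ (a ⊗ₜ b) * mulMap v₁ v₂ t
        - (2 : k) • (mulMap u₁ u₂ (oddPart₂ P (a ⊗ₜ b)) * mulMap v₁ v₂ (oddPart₂ P t)))
      (fun l m c hc d hd => ?_) (fun s t hs ht => ?_) t
    · rw [oddPart₂_tmul hP ha hb, oddPart₂_tmul hP hc hd]
      simp only [mulMap_tmul, mul_assoc, h₁₂.mul_assoc_left ha hd, h₁₁.mul_assoc_left ha hc,
        h₂₂ _ _ b hb d hd, h₂₁.mul_assoc_left hb hc, mul_smul_comm, smul_smul, sg_mul_sg]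
      rcases parity_cases i with rfl | rfl <;> rcases parity_cases j with rfl | rfl <;>
        rcases parity_cases l with rfl | rfl <;> rcases parity_cases m with rfl | rfl <;>
        simp [sg, CharTwo.add_self_eq_zero, two_smul, mul_assoc]
    · simp only [map_add, mul_add, add_mul, hs, ht, smul_add]
      abel
  · simp only [map_add, mul_add, add_mul, hs, ht, smul_add]
    abel

end Convolution

section RegularRepresentations

variable {k : Type} [Field k] {A : Type} [AddCommGroup A] [Module k A]
variable {W : Type} [AddCommGroup W] [Module k W]

/-- Left multiplication on the first factor of `A ⊗ W`. -/
def leftAct (W : Type) [AddCommGroup W] [Module k W] (mul : A →ₗ[k] A →ₗ[k] A) :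
    A →ₗ[k] Module.End k (A ⊗[k] W) :=
  (TensorProduct.mapBilinear (RingHom.id k) A W A W).flip LinearMap.id ∘ₗ mul

@[simp] lemma leftAct_tmul (mul : A →ₗ[k] A →ₗ[k] A) (a x : A) (w : W) :
    leftAct W mul a (x ⊗ₜ w) = mul a x ⊗ₜ w := rfl

/-- The action `j` of `A` on `W`, extended to the second factor of `A ⊗ W` with Koszul signs. -/
def rightAct (P : A →ₗ[k] A) (j : A →ₗ[k] Module.End k W) : A →ₗ[k] Module.End k (A ⊗[k] W) :=
  (TensorProduct.mapBilinear (RingHom.id k) A W A W) LinearMap.id ∘ₗ j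
    - (2 : k) • ((TensorProduct.mapBilinear (RingHom.id k) A W A W) P ∘ₗ j ∘ₗ P)

variable {mul : A →ₗ[k] A →ₗ[k] A} {one : A} {g : ZMod 2 → Submodule k A}
  {m2 : (A ⊗[k] A) →ₗ[k] (A ⊗[k] A) →ₗ[k] (A ⊗[k] A)}
  {cop : A →ₗ[k] A ⊗[k] A} {cou : A →ₗ[k] k} {ant : A →ₗ[k] A}
  {P : A →ₗ[k] A} {j j' : A →ₗ[k] Module.End k W}

lemma rightAct_tmul (hP : IsOddPart g P) {i l : ZMod 2} {a x : A} (ha : a ∈ g i) (hx : x ∈ g l)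
    (w : W) : rightAct P j a (x ⊗ₜ w) = sg k (i * l) • (x ⊗ₜ[k] j a w) := by
  have h : rightAct P j a (x ⊗ₜ w) = x ⊗ₜ[k] j a w - (2 : k) • (P x ⊗ₜ[k] j (P a) w) := rfl
  rw [h, hP i a ha, hP l x hx]
  rcases parity_cases i with rfl | rfl <;> rcases parity_cases l with rfl | rfl <;>
    simp [sg, two_smul]

lemma end_tensor_ext (hsup : g 0 ⊔ g 1 = ⊤) {V : Type} [AddCommGroup V] [Module k V]
    {S T : A ⊗[k] W →ₗ[k] V}
    (h : ∀ i, ∀ x ∈ g i, ∀ w, S (x ⊗ₜ w) = T (x ⊗ₜ w)) : S = T := by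
  refine TensorProduct.ext' fun x w => ?_
  refine homogeneous_induction hsup (P := fun x => S (x ⊗ₜ w) = T (x ⊗ₜ w))
    (fun i x hx => h i x hx w) (fun a b ha hb => ?_) x
  simp only [TensorProduct.add_tmul, map_add, ha, hb]

lemma isAlgMap_regular (hH : IsHopfSData k A mul one g m2 cop cou ant) :
    IsAlgMap (E := Module.End k A) mul one mul where
  map_one := LinearMap.ext hH.one_mul
  map_mul a b := LinearMap.ext (hH.mul_assoc a b)

lemma isAlgMap_leftAct (hH : IsHopfSData k A mul one g m2 cop cou ant) :
    IsAlgMap mul one (leftAct W mul) where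
  map_one := TensorProduct.ext' fun x w => by simp [hH.one_mul]
  map_mul a b := TensorProduct.ext' fun x w => by simp [hH.mul_assoc]

lemma isAlgMap_rightAct (hH : IsHopfSData k A mul one g m2 cop cou ant) (hP : IsOddPart g P)
    (hj : IsAlgMap mul one j) : IsAlgMap mul one (rightAct P j) where
  map_one := end_tensor_ext hH.sup_eq fun l x hx w => by
    simp [rightAct_tmul hP hH.one_mem hx, hj.map_one, sg_zero]
  map_mul a b := by
    refine homogeneous_induction hH.sup_eq
      (P := fun a => rightAct P j (mul a b) = rightAct P j a * rightAct P j b)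
      (fun i a ha => ?_) (fun s t hs ht => ?_) a
    · refine homogeneous_induction hH.sup_eq
        (P := fun b => rightAct P j (mul a b) = rightAct P j a * rightAct P j b)
        (fun l b hb => ?_) (fun s t hs ht => ?_) b
      · refine end_tensor_ext hH.sup_eq fun m x hx w => ?_
        rw [rightAct_tmul hP (hH.mul_mem ha hb) hx, Module.End.mul_apply,
          rightAct_tmul hP hb hx, map_smul, rightAct_tmul hP ha hx, smul_smul, sg_mul_sg,
          hj.map_mul, Module.End.mul_apply]
        congr 2
        ring
      · simp only [map_add, mul_add, hs, ht]
    · simp only [map_add, LinearMap.add_apply, add_mul, hs, ht]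

lemma superCommute_leftAct_rightAct (hH : IsHopfSData k A mul one g m2 cop cou ant)
    (hP : IsOddPart g P) : SuperCommute g (leftAct W mul) (rightAct P j) := by
  intro i l a ha b hb
  refine end_tensor_ext hH.sup_eq fun m x hx w => ?_
  simp only [LinearMap.smul_apply, Module.End.mul_apply, leftAct_tmul, rightAct_tmul hP hb hx,
    rightAct_tmul hP hb (hH.mul_mem ha hx), map_smul, smul_smul, sg_mul_sg]
  congr 2
  ring

lemma SuperCommute.rightAct (hsup : g 0 ⊔ g 1 = ⊤) (hP : IsOddPart g P)
    (h : SuperCommute g j j') : SuperCommute g (rightAct P j) (rightAct P j') := by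
  intro i l a ha b hb
  refine end_tensor_ext hsup fun m x hx w => ?_
  have hw := LinearMap.congr_fun (h i l a ha b hb) w
  simp only [LinearMap.smul_apply, Module.End.mul_apply] at hw
  simp only [LinearMap.smul_apply, Module.End.mul_apply, rightAct_tmul hP hb hx,
    rightAct_tmul hP ha hx, map_smul, smul_smul, sg_mul_sg, hw, TensorProduct.tmul_smul]
  congr 2
  ring

lemma exists_isSMul3 (hH : IsHopfSData k A mul one g m2 cop cou ant) :
    ∃ m3, IsSMul3 k A g mul m3 := by
  obtain ⟨P, hP⟩ := exists_isOddPart hH.sup_eq hH.inf_eq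
  let e := TensorProduct.assoc k A A A
  let Θ : (A ⊗[k] A) ⊗[k] A →ₗ[k] Module.End k (A ⊗[k] (A ⊗[k] A)) :=
    mulMap (mulMap (leftAct _ mul) (rightAct P (leftAct _ mul)))
      (rightAct P (rightAct P mul))
  refine ⟨(Θ.compr₂ e.symm.toLinearMap).compl₂ e.toLinearMap, ?_⟩
  intro pb pc pd pe a b c d x y hb hc hd hx
  have h : Θ ((a ⊗ₜ b) ⊗ₜ c) (e ((d ⊗ₜ x) ⊗ₜ y))
      = sg k (pb * pd + pc * pd + pc * pe) • (mul a d ⊗ₜ[k] (mul b x ⊗ₜ[k] mul c y)) := by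
    simp only [Θ, e, mulMap_tmul, TensorProduct.assoc_tmul, Module.End.mul_apply,
      rightAct_tmul hP hc hd, rightAct_tmul hP hb hd, rightAct_tmul hP hc hx, map_smul,
      leftAct_tmul, smul_smul, sg_mul_sg, TensorProduct.tmul_smul]
    congr 2
    ring
  simp only [LinearMap.compl₂_apply, LinearMap.compr₂_apply, LinearEquiv.coe_coe, h, map_smul]
  rfl

end RegularRepresentations

section TwistParity

variable {k : Type} [Field k] {A : Type} [AddCommGroup A] [Module k A]
variable {E : Type} [Ring E] [Algebra k E]
variable {mul : A →ₗ[k] A →ₗ[k] A} {one : A} {g : ZMod 2 → Submodule k A}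
  {m2 : (A ⊗[k] A) →ₗ[k] (A ⊗[k] A) →ₗ[k] (A ⊗[k] A)}
  {cop : A →ₗ[k] A ⊗[k] A} {cou : A →ₗ[k] k} {ant : A →ₗ[k] A}
  {f fi : A ⊗[k] A}

lemma IsTwist.mulMap_eq (hH : IsHopfSData k A mul one g m2 cop cou ant)
    (hf : IsTwist k A mul one g m2 cop cou f fi) {u v w : A →ₗ[k] E}
    (hu : IsAlgMap mul one u) (hv : IsAlgMap mul one v) (hw : IsAlgMap mul one w)
    (huv : SuperCommute g u v) (huw : SuperCommute g u w) (hvw : SuperCommute g v w) :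
    mulMap u v f * mulMap (mulMap u v ∘ₗ cop) w f
      = mulMap v w f * mulMap u (mulMap v w ∘ₗ cop) f := by
  obtain ⟨m3, hm3⟩ := exists_isSMul3 hH
  have h := congrArg (mulMap (mulMap u v) w) (hf.2.2.2.2 m3 hm3)
  rwa [mulMap₃_mul hH.sup_eq hm3 hu hv hw huv huw hvw,
    mulMap₃_mul hH.sup_eq hm3 hu hv hw huv huw hvw, mulMap₃_tmul_one hw, mulMap₃_map_cop_id,
    mulMap₃_assoc_symm_tmul, mulMap₃_assoc_symm_map_id_cop, hu.map_one, one_mul] at h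

/-- The pentagon relation forces `F₁₂` and `F₃₄` to commute. -/
lemma IsTwist.commute (hH : IsHopfSData k A mul one g m2 cop cou ant)
    (hf : IsTwist k A mul one g m2 cop cou f fi) {u₁ u₂ u₃ u₄ : A →ₗ[k] E}
    (h₁ : IsAlgMap mul one u₁) (h₂ : IsAlgMap mul one u₂) (h₃ : IsAlgMap mul one u₃)
    (h₄ : IsAlgMap mul one u₄)
    (h₁₂ : SuperCommute g u₁ u₂) (h₁₃ : SuperCommute g u₁ u₃) (h₁₄ : SuperCommute g u₁ u₄)
    (h₂₃ : SuperCommute g u₂ u₃) (h₂₄ : SuperCommute g u₂ u₄) (h₃₄ : SuperCommute g u₃ u₄) :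
    Commute (mulMap u₁ u₂ f) (mulMap u₃ u₄ f) := by
  have e₁ := hf.mulMap_eq hH h₁ h₂ h₃ h₁₂ h₁₃ h₂₃
  have e₂ := hf.mulMap_eq hH h₁ (h₂.mulMap_comp_cop hH h₃ h₂₃) h₄
    (h₁₂.mulMap_comp_cop_right hH h₁₃) h₁₄ (h₂₄.mulMap_comp_cop_left hH h₃₄)
  have e₃ := hf.mulMap_eq hH h₂ h₃ h₄ h₂₃ h₂₄ h₃₄
  have e₄ := hf.mulMap_eq hH (h₁.mulMap_comp_cop hH h₂ h₁₂) h₃ h₄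
    (h₁₃.mulMap_comp_cop_left hH h₂₃) (h₁₄.mulMap_comp_cop_left hH h₂₄) h₃₄
  have e₅ := hf.mulMap_eq hH h₁ h₂ (h₃.mulMap_comp_cop hH h₄ h₃₄) h₁₂
    (h₁₃.mulMap_comp_cop_right hH h₁₄) (h₂₃.mulMap_comp_cop_right hH h₂₄)
  have h₁₂' := h₁.mulMap_comp_cop hH h₂ h₁₂
  have h₃₄' := h₃.mulMap_comp_cop hH h₄ h₃₄
  have hc : SuperCommute g (mulMap u₁ u₂ ∘ₗ cop) (mulMap u₃ u₄ ∘ₗ cop) :=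
    SuperCommute.mulMap_comp_cop_left hH (h₁₃.mulMap_comp_cop_right hH h₁₄)
      (h₂₃.mulMap_comp_cop_right hH h₂₄)
  rw [mulMap_comp_cop_assoc hH] at e₄
  rw [mulMap_comp_cop_assoc hH] at e₂
  have hX : mulMap (mulMap u₁ u₂ ∘ₗ cop) (mulMap u₃ u₄ ∘ₗ cop) f
      * mulMap (mulMap u₁ u₂ ∘ₗ cop) (mulMap u₃ u₄ ∘ₗ cop) fi = 1 := by
    rw [← mulMap_mul hH.sup_eq hH.smul2 h₁₂' h₃₄' hc, hf.1, mulMap_tmul, h₁₂'.map_one,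
      h₃₄'.map_one, one_mul]
  set X := mulMap (mulMap u₁ u₂ ∘ₗ cop) (mulMap u₃ u₄ ∘ₗ cop) f
  set Y := mulMap (mulMap u₁ u₂ ∘ₗ cop) (mulMap u₃ u₄ ∘ₗ cop) fi
  have key : mulMap u₁ u₂ f * mulMap u₃ u₄ f * X = mulMap u₃ u₄ f * mulMap u₁ u₂ f * X := by
    rw [mul_assoc, ← e₄, ← mul_assoc, e₁, mul_assoc, e₂, ← mul_assoc, e₃, mul_assoc, ← e₅,
      ← mul_assoc]
  calc mulMap u₁ u₂ f * mulMap u₃ u₄ f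
      = mulMap u₁ u₂ f * mulMap u₃ u₄ f * X * Y := by rw [mul_assoc _ X Y, hX, mul_one]
    _ = mulMap u₃ u₄ f * mulMap u₁ u₂ f := by rw [key, mul_assoc _ X Y, hX, mul_one]

/-- If `t₁₂` and `t₃₄` commute in every representation, then `t` is even, or the characteristic
is two. -/
lemma mem_evenTensors_of_commute (hH : IsHopfSData k A mul one g m2 cop cou ant)
    {t : A ⊗[k] A}
    (ht : ∀ (u₁ u₂ u₃ u₄ : A →ₗ[k] Module.End k (A ⊗[k] (A ⊗[k] (A ⊗[k] A)))),
      IsAlgMap mul one u₁ → IsAlgMap mul one u₂ → IsAlgMap mul one u₃ → IsAlgMap mul one u₄ →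
      SuperCommute g u₁ u₂ → SuperCommute g u₁ u₃ → SuperCommute g u₁ u₄ →
      SuperCommute g u₂ u₃ → SuperCommute g u₂ u₄ → SuperCommute g u₃ u₄ →
      Commute (mulMap u₁ u₂ t) (mulMap u₃ u₄ t)) :
    t ∈ evenTensors g := by
  obtain ⟨P, hP⟩ := exists_isOddPart hH.sup_eq hH.inf_eq
  refine mem_evenTensors hH.sup_eq hP ?_
  let u₁ : A →ₗ[k] Module.End k (A ⊗[k] (A ⊗[k] (A ⊗[k] A))) := leftAct _ mul
  let u₂ : A →ₗ[k] Module.End k (A ⊗[k] (A ⊗[k] (A ⊗[k] A))) := rightAct P (leftAct _ mul)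
  let u₃ : A →ₗ[k] Module.End k (A ⊗[k] (A ⊗[k] (A ⊗[k] A))) :=
    rightAct P (rightAct P (leftAct _ mul))
  let u₄ : A →ₗ[k] Module.End k (A ⊗[k] (A ⊗[k] (A ⊗[k] A))) :=
    rightAct P (rightAct P (rightAct P mul))
  have h₁₂ : SuperCommute g u₁ u₂ := superCommute_leftAct_rightAct hH hP
  have h₁₃ : SuperCommute g u₁ u₃ := superCommute_leftAct_rightAct hH hP
  have h₁₄ : SuperCommute g u₁ u₄ := superCommute_leftAct_rightAct hH hP
  have h₂₃ : SuperCommute g u₂ u₃ :=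
    (superCommute_leftAct_rightAct hH hP).rightAct hH.sup_eq hP
  have h₂₄ : SuperCommute g u₂ u₄ :=
    (superCommute_leftAct_rightAct hH hP).rightAct hH.sup_eq hP
  have h₃₄ : SuperCommute g u₃ u₄ :=
    ((superCommute_leftAct_rightAct hH hP).rightAct hH.sup_eq hP).rightAct hH.sup_eq hP
  have hcomm := ht u₁ u₂ u₃ u₄ (isAlgMap_leftAct hH)
    (isAlgMap_rightAct hH hP (isAlgMap_leftAct hH))
    (isAlgMap_rightAct hH hP (isAlgMap_rightAct hH hP (isAlgMap_leftAct hH)))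
    (isAlgMap_rightAct hH hP (isAlgMap_rightAct hH hP (isAlgMap_rightAct hH hP
      (isAlgMap_regular hH)))) h₁₂ h₁₃ h₁₄ h₂₃ h₂₄ h₃₄
  have hodd : (2 : k) • (mulMap u₁ u₂ (oddPart₂ P t) * mulMap u₃ u₄ (oddPart₂ P t)) = 0 := by
    have h := oddPart₂_commutator hH.sup_eq hP h₁₃ h₁₄ h₂₃ h₂₄ t t
    rw [hcomm.eq] at h
    exact sub_eq_self.1 h.symm
  have hvec : ∀ x y : A ⊗[k] A,
      (mulMap u₁ u₂ x * mulMap u₃ u₄ y) (one ⊗ₜ (one ⊗ₜ (one ⊗ₜ one)))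
        = TensorProduct.assoc k A A (A ⊗[k] A) (x ⊗ₜ y) := by
    intro x y
    have act : ∀ (V : Type) [AddCommGroup V] [Module k V] (j : A →ₗ[k] Module.End k V)
        (a : A) (w : V), rightAct P j a (one ⊗ₜ w) = one ⊗ₜ[k] j a w := by
      intro V _ _ j a w
      refine homogeneous_induction hH.sup_eq
        (P := fun a => rightAct P j a (one ⊗ₜ w) = one ⊗ₜ[k] j a w)
        (fun i a ha => ?_) (fun s t hs ht => ?_) a
      · simp [rightAct_tmul hP ha hH.one_mem, sg_zero]
      · simp only [map_add, LinearMap.add_apply, hs, ht, TensorProduct.tmul_add]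
    induction x with
    | zero => simp
    | add s t hs ht => simp only [map_add, add_mul, LinearMap.add_apply, hs, ht,
        TensorProduct.add_tmul]
    | tmul a b =>
      induction y with
      | zero => simp
      | add s t hs ht => simp only [map_add, mul_add, LinearMap.add_apply, hs, ht,
          TensorProduct.tmul_add]
      | tmul c d =>
        simp only [mulMap_tmul, Module.End.mul_apply, u₁, u₂, u₃, u₄, act, leftAct_tmul,
          hH.mul_one, TensorProduct.assoc_tmul]
  refine (smul_eq_zero.1 hodd).imp id fun h => ?_
  have hzero : oddPart₂ P t ⊗ₜ[k] oddPart₂ P t = 0 := by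
    rw [← LinearEquiv.map_eq_zero_iff (TensorProduct.assoc k A A (A ⊗[k] A)), ← hvec, h,
      LinearMap.zero_apply]
  refine (Module.forall_dual_apply_eq_zero_iff k _).1 fun φ => ?_
  simpa using congrArg (TensorProduct.dualDistrib k _ _ (φ ⊗ₜ φ)) hzero

lemma IsTwist.mem_evenTensors (hH : IsHopfSData k A mul one g m2 cop cou ant)
    (hf : IsTwist k A mul one g m2 cop cou f fi) : f ∈ evenTensors g :=
  mem_evenTensors_of_commute hH fun _ _ _ _ h₁ h₂ h₃ h₄ h₁₂ h₁₃ h₁₄ h₂₃ h₂₄ h₃₄ =>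
    hf.commute hH h₁ h₂ h₃ h₄ h₁₂ h₁₃ h₁₄ h₂₃ h₂₄ h₃₄

lemma IsTwist.inv_mem_evenTensors (hH : IsHopfSData k A mul one g m2 cop cou ant)
    (hf : IsTwist k A mul one g m2 cop cou f fi) : fi ∈ evenTensors g := by
  refine mem_evenTensors_of_commute hH fun u₁ u₂ u₃ u₄ h₁ h₂ h₃ h₄ h₁₂ h₁₃ h₁₄ h₂₃ h₂₄ h₃₄ => ?_
  have inv : ∀ {u v : A →ₗ[k] Module.End k (A ⊗[k] (A ⊗[k] (A ⊗[k] A)))},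
      IsAlgMap mul one u → IsAlgMap mul one v → SuperCommute g u v →
      ∃ x : (Module.End k (A ⊗[k] (A ⊗[k] (A ⊗[k] A))))ˣ,
        mulMap u v f = x ∧ mulMap u v fi = ↑x⁻¹ := by
    intro u v hu hv huv
    refine ⟨⟨mulMap u v f, mulMap u v fi, ?_, ?_⟩, rfl, rfl⟩
    · rw [← mulMap_mul hH.sup_eq hH.smul2 hu hv huv, hf.1, mulMap_tmul, hu.map_one, hv.map_one,
        one_mul]
    · rw [← mulMap_mul hH.sup_eq hH.smul2 hu hv huv, hf.2.1, mulMap_tmul, hu.map_one,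
        hv.map_one, one_mul]
  have hcomm := hf.commute hH h₁ h₂ h₃ h₄ h₁₂ h₁₃ h₁₄ h₂₃ h₂₄ h₃₄
  obtain ⟨x, hx, hx'⟩ := inv h₁ h₂ h₁₂
  obtain ⟨y, hy, hy'⟩ := inv h₃ h₄ h₃₄
  rw [hx, hy] at hcomm
  rw [hx', hy']
  exact (hcomm.units_inv_left).units_inv_right

end TwistParity

section DualPairing

variable {k : Type} [Field k] {A : Type} [AddCommGroup A] [Module k A]
variable {mul : A →ₗ[k] A →ₗ[k] A} {one : A} {g : ZMod 2 → Submodule k A}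
  {m2 : (A ⊗[k] A) →ₗ[k] (A ⊗[k] A) →ₗ[k] (A ⊗[k] A)}
  {cop : A →ₗ[k] A ⊗[k] A} {cou : A →ₗ[k] k} {ant : A →ₗ[k] A}

lemma evenTensors_induction {P : A ⊗[k] A → Prop}
    (hom : ∀ i j, ∀ a ∈ g i, ∀ b ∈ g j, (i = j ∨ ∀ c, sg k c = 1) → P (a ⊗ₜ b))
    (add : ∀ s t, P s → P t → P (s + t)) {t : A ⊗[k] A} (ht : t ∈ evenTensors g) : P t := by
  refine Submodule.span_induction (p := fun t _ => ∀ c : k, P (c • t)) ?_ ?_ ?_ ?_ ht 1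
    |> fun h => by simpa using h
  · rintro _ ⟨i, j, a, ha, b, hb, hij, rfl⟩ c
    rw [TensorProduct.smul_tmul']
    exact hom i j _ (Submodule.smul_mem _ _ ha) b hb hij
  · intro c
    simpa using hom 0 0 0 (zero_mem _) 0 (zero_mem _) (Or.inl rfl)
  · intro s t _ _ hs ht c
    rw [smul_add]
    exact add _ _ (hs c) (ht c)
  · intro d t _ ht c
    rw [smul_smul]
    exact ht _

lemma cop_induction (hH : IsHopfSData k A mul one g m2 cop cou ant) {P : A ⊗[k] A → Prop}
    {i : ZMod 2} {x : A} (hx : x ∈ g i)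
    (hom : ∀ j l, ∀ a ∈ g j, ∀ b ∈ g l, i = j + l → P (a ⊗ₜ b))
    (add : ∀ s t, P s → P t → P (s + t)) : P (cop x) := by
  refine Submodule.span_induction (p := fun t _ => ∀ c : k, P (c • t)) ?_ ?_ ?_ ?_
    (hH.comul_parity i x hx) 1 |> fun h => by simpa using h
  · rintro _ ⟨j, a, ha, b, hb, rfl⟩ c
    rw [TensorProduct.smul_tmul']
    refine hom j (i + j) _ (Submodule.smul_mem _ _ ha) b hb ?_
    rw [add_comm i, CharTwo.add_cancel_left]
  · intro c
    simpa using hom i 0 0 (zero_mem _) 0 (zero_mem _) (add_zero i).symm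
  · intro s t _ _ hs ht c
    rw [smul_add]
    exact add _ _ (hs c) (ht c)
  · intro d t _ ht c
    rw [smul_smul]
    exact ht _

lemma dualGrading_eq_or_apply_eq_zero {i j : ZMod 2} {φ : Module.Dual k A} {x : A}
    (hφ : φ ∈ dualGrading k A g i) (hx : x ∈ g j) : i = j ∨ φ x = 0 := by
  by_cases h : i = j
  · exact Or.inl h
  · have aux : ∀ i j : ZMod 2, ¬i = j → j = i + 1 := by decide
    have : j = i + 1 := aux i j h
    exact Or.inr (hφ x (this ▸ hx))

variable {B2 : (Module.Dual k A ⊗[k] Module.Dual k A) →ₗ[k] (A ⊗[k] A) →ₗ[k] k}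
  {copD : Module.Dual k A →ₗ[k] Module.Dual k A ⊗[k] Module.Dual k A}

lemma IsDualPair2.tmul_tmul (hB2 : IsDualPair2 k A g B2)
    (hsup : dualGrading k A g 0 ⊔ dualGrading k A g 1 = ⊤) {i j : ZMod 2} {x y : A}
    (hx : x ∈ g i) (hy : y ∈ g j) (φ ψ : Module.Dual k A) :
    B2 (φ ⊗ₜ ψ) (x ⊗ₜ y) = sg k (i * j) * (φ x * ψ y) := by
  refine homogeneous_induction hsup
    (P := fun ψ => B2 (φ ⊗ₜ ψ) (x ⊗ₜ y) = sg k (i * j) * (φ x * ψ y))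
    (fun l ψ hψ => ?_) (fun s t hs ht => ?_) ψ
  · rw [hB2 l i φ ψ x y hψ hx]
    rcases dualGrading_eq_or_apply_eq_zero hψ hy with rfl | h
    · rw [mul_comm l]
    · simp [h]
  · simp only [TensorProduct.tmul_add, map_add, LinearMap.add_apply, hs, ht]
    ring

lemma IsDualPair2.apply_tmul (hB2 : IsDualPair2 k A g B2)
    (hsup : dualGrading k A g 0 ⊔ dualGrading k A g 1 = ⊤) {i j : ZMod 2} {x y : A}
    (hx : x ∈ g i) (hy : y ∈ g j) (s : Module.Dual k A ⊗[k] Module.Dual k A) :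
    B2 s (x ⊗ₜ y) = sg k (i * j) * TensorProduct.dualDistrib k A A s (x ⊗ₜ y) := by
  induction s with
  | zero => simp
  | add s t hs ht => simp only [map_add, LinearMap.add_apply, hs, ht, mul_add]
  | tmul φ ψ => rw [hB2.tmul_tmul hsup hx hy, TensorProduct.dualDistrib_apply]

lemma dualDistrib_comul (hB2 : IsDualPair2 k A g B2)
    (hsup : dualGrading k A g 0 ⊔ dualGrading k A g 1 = ⊤)
    (hcop : ∀ φ x y, B2 (copD φ) (x ⊗ₜ y) = φ (mul x y)) {i j : ZMod 2} {x y : A}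
    (hx : x ∈ g i) (hy : y ∈ g j) (φ : Module.Dual k A) :
    TensorProduct.dualDistrib k A A (copD φ) (x ⊗ₜ y) = sg k (i * j) * φ (mul x y) := by
  rw [← hcop, hB2.apply_tmul hsup hx hy, ← mul_assoc, sg_self_mul, one_mul]

lemma Rep.sum_apply_mul_apply (hB2 : IsDualPair2 k A g B2)
    (hsup : dualGrading k A g 0 ⊔ dualGrading k A g 1 = ⊤)
    (hcop : ∀ φ x y, B2 (copD φ) (x ⊗ₜ y) = φ (mul x y)) {φ : Module.Dual k A}
    {ι : Type} {s : Finset ι} {a b : ι → Module.Dual k A} {pa pb : ι → ZMod 2}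
    (h : Rep k (Module.Dual k A) (dualGrading k A g) (copD φ) ι s a b pa pb)
    {i j : ZMod 2} {x y : A} (hx : x ∈ g i) (hy : y ∈ g j) :
    ∑ n ∈ s, a n x * b n y = sg k (i * j) * φ (mul x y) := by
  rw [← dualDistrib_comul hB2 hsup hcop hx hy, h.1]
  simp [LinearMap.sum_apply]

lemma Rep3.sum_apply_mul_apply (hH : IsHopfSData k A mul one g m2 cop cou ant)
    (hB2 : IsDualPair2 k A g B2)
    (hsup : dualGrading k A g 0 ⊔ dualGrading k A g 1 = ⊤)
    (hcop : ∀ φ x y, B2 (copD φ) (x ⊗ₜ y) = φ (mul x y)) {φ : Module.Dual k A}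
    {ι : Type} {s : Finset ι} {a b c : ι → Module.Dual k A} {pa pb pc : ι → ZMod 2}
    (h : Rep3 k (Module.Dual k A) (dualGrading k A g) copD φ ι s a b c pa pb pc)
    {i j l : ZMod 2} {x y z : A} (hx : x ∈ g i) (hy : y ∈ g j) (hz : z ∈ g l) :
    ∑ n ∈ s, a n x * b n y * c n z
      = sg k (i * j + (i + j) * l) * φ (mul (mul x y) z) := by
  let T := TensorProduct.lift ((LinearMap.mul k k).compl₁₂
    ((TensorProduct.dualDistrib k A A).flip (x ⊗ₜ y)) (Module.Dual.eval k A z))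
  have hT : ∀ t, T (TensorProduct.map copD LinearMap.id t)
      = sg k (i * j) * TensorProduct.dualDistrib k A A t (mul x y ⊗ₜ z) := by
    intro t
    induction t with
    | zero => simp
    | add s t hs ht => simp only [map_add, LinearMap.add_apply, hs, ht, mul_add]
    | tmul φ ψ =>
      simp [T, dualDistrib_comul hB2 hsup hcop hx hy, mul_assoc]
  have h' := congrArg T h.1
  rw [hT, dualDistrib_comul hB2 hsup hcop (hH.mul_mem hx hy) hz, sg_mul_sg_assoc] at h'
  rw [h']
  simp [T]

lemma sum_pairing_mul_pairing (hH : IsHopfSData k A mul one g m2 cop cou ant)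
    (hB2 : IsDualPair2 k A g B2)
    (hsup : dualGrading k A g 0 ⊔ dualGrading k A g 1 = ⊤)
    (hcop : ∀ φ x y, B2 (copD φ) (x ⊗ₜ y) = φ (mul x y)) {φ ψ : Module.Dual k A}
    {ι : Type} {s : Finset ι} {a b : ι → Module.Dual k A} {pa pb : ι → ZMod 2}
    (h : Rep k (Module.Dual k A) (dualGrading k A g) (copD φ) ι s a b pa pb)
    {ι' : Type} {s' : Finset ι'} {c d : ι' → Module.Dual k A} {pc pd : ι' → ZMod 2}
    (h' : Rep k (Module.Dual k A) (dualGrading k A g) (copD ψ) ι' s' c d pc pd)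
    {e : A ⊗[k] A} (he : e ∈ evenTensors g) (t : A ⊗[k] A) :
    ∑ i ∈ s, ∑ j ∈ s', sg k (pb i * pc j) * (B2 (a i ⊗ₜ c j) e * B2 (b i ⊗ₜ d j) t)
      = B2 (φ ⊗ₜ ψ) (m2 e t) := by
  refine evenTensors_induction (P := fun e => ∑ i ∈ s, ∑ j ∈ s', sg k (pb i * pc j) *
    (B2 (a i ⊗ₜ c j) e * B2 (b i ⊗ₜ d j) t) = B2 (φ ⊗ₜ ψ) (m2 e t)) ?_ ?_ he
  · intro p q x hx y hy hpq
    refine homogeneous_induction₂ hH.sup_eq (P := fun t => ∑ i ∈ s, ∑ j ∈ s',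
      sg k (pb i * pc j) * (B2 (a i ⊗ₜ c j) (x ⊗ₜ y) * B2 (b i ⊗ₜ d j) t)
        = B2 (φ ⊗ₜ ψ) (m2 (x ⊗ₜ y) t)) ?_ ?_ t
    · intro r l z hz w hw
      have key : ∀ i ∈ s, ∀ j ∈ s', sg k (pb i * pc j) *
          (B2 (a i ⊗ₜ c j) (x ⊗ₜ y) * B2 (b i ⊗ₜ d j) (z ⊗ₜ w))
          = sg k (r * q + p * q + r * l) * ((a i x * b i z) * (c j y * d j w)) := by
        intro i hi j hj
        rw [hB2.tmul_tmul hsup hx hy, hB2.tmul_tmul hsup hz hw]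
        rcases dualGrading_eq_or_apply_eq_zero (h.2 i hi).2 hz with h₁ | h₁
        · rcases dualGrading_eq_or_apply_eq_zero (h'.2 j hj).1 hy with h₂ | h₂
          · rw [h₁, h₂, ← sg_mul_sg, ← sg_mul_sg]
            ring
          · simp [h₂]
        · simp [h₁]
      rw [Finset.sum_congr rfl fun i hi => Finset.sum_congr rfl fun j hj => key i hi j hj]
      simp only [← Finset.mul_sum]
      rw [← Finset.sum_mul, h.sum_apply_mul_apply hB2 hsup hcop hx hz,
        h'.sum_apply_mul_apply hB2 hsup hcop hy hw, hH.smul2 q r x y z w hy hz, map_smul,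
        hB2.tmul_tmul hsup (hH.mul_mem hx hz) (hH.mul_mem hy hw), smul_eq_mul, sg_mul_sg_assoc,
        mul_mul_mul_comm, sg_mul_sg, sg_mul_sg_assoc]
      congr 1
      rcases hpq with rfl | hsg
      · congr 1
        have aux : ∀ p r l : ZMod 2,
            r * p + p * p + r * l + (p * r + p * l) = p * r + (p + r) * (p + l) := by decide
        exact aux p r l
      · rw [hsg, hsg]
    · intro t t' ht ht'
      simp only [map_add, mul_add, Finset.sum_add_distrib, ht, ht']
  · intro e e' he he'
    simp only [map_add, LinearMap.add_apply, add_mul, mul_add, Finset.sum_add_distrib, he, he']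

end DualPairing

section Representations

variable {k : Type} [Field k] {M : Type} [AddCommGroup M] [Module k M]
  {g : ZMod 2 → Submodule k M}

lemma exists_rep (hsup : g 0 ⊔ g 1 = ⊤) (t : M ⊗[k] M) :
    ∃ (ι : Type) (s : Finset ι) (a b : ι → M) (pa pb : ι → ZMod 2),
      Rep k M g t ι s a b pa pb := by
  refine homogeneous_induction₂ hsup (P := fun t => ∃ (ι : Type) (s : Finset ι) (a b : ι → M)
    (pa pb : ι → ZMod 2), Rep k M g t ι s a b pa pb) ?_ ?_ t
  · intro i j a ha b hb
    exact ⟨Unit, {()}, fun _ => a, fun _ => b, fun _ => i, fun _ => j, by simp,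
      fun _ _ => ⟨ha, hb⟩⟩
  · rintro _ _ ⟨ι, s, a, b, pa, pb, rfl, h⟩ ⟨ι', s', a', b', pa', pb', rfl, h'⟩
    refine ⟨ι ⊕ ι', s.disjSum s', Sum.elim a a', Sum.elim b b', Sum.elim pa pa',
      Sum.elim pb pb', by simp [Finset.sum_disjSum], ?_⟩
    rintro (i | i) hi
    · exact h i (by simpa using hi)
    · exact h' i (by simpa using hi)

lemma exists_rep₃ (hsup : g 0 ⊔ g 1 = ⊤) (cop : M →ₗ[k] M ⊗[k] M) (x : M) :
    ∃ (ι : Type) (s : Finset ι) (a b c : ι → M) (pa pb pc : ι → ZMod 2),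
      Rep3 k M g cop x ι s a b c pa pb pc := by
  refine homogeneous_induction₃ hsup (P := fun t => ∃ (ι : Type) (s : Finset ι)
    (a b c : ι → M) (pa pb pc : ι → ZMod 2), t = ∑ i ∈ s, (a i ⊗ₜ[k] b i) ⊗ₜ[k] c i ∧
      ∀ i ∈ s, a i ∈ g (pa i) ∧ b i ∈ g (pb i) ∧ c i ∈ g (pc i)) ?_ ?_ _
  · intro i j l a ha b hb c hc
    exact ⟨Unit, {()}, fun _ => a, fun _ => b, fun _ => c, fun _ => i, fun _ => j, fun _ => l,
      by simp, fun _ _ => ⟨ha, hb, hc⟩⟩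
  · rintro _ _ ⟨ι, s, a, b, c, pa, pb, pc, rfl, h⟩ ⟨ι', s', a', b', c', pa', pb', pc', rfl, h'⟩
    refine ⟨ι ⊕ ι', s.disjSum s', Sum.elim a a', Sum.elim b b', Sum.elim c c',
      Sum.elim pa pa', Sum.elim pb pb', Sum.elim pc pc', by simp [Finset.sum_disjSum], ?_⟩
    rintro (i | i) hi
    · exact h i (by simpa using hi)
    · exact h' i (by simpa using hi)

end Representations

section Nondegeneracy

variable {k : Type} [Field k] {A : Type} [AddCommGroup A] [Module k A]
  [FiniteDimensional k A] {g : ZMod 2 → Submodule k A}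
  {B2 : (Module.Dual k A ⊗[k] Module.Dual k A) →ₗ[k] (A ⊗[k] A) →ₗ[k] k}

lemma IsDualPair2.flip_injective (hB2 : IsDualPair2 k A g B2)
    (hD : dualGrading k A g 0 ⊔ dualGrading k A g 1 = ⊤)
    (hsup : g 0 ⊔ g 1 = ⊤) (hinf : g 0 ⊓ g 1 = ⊥) : Function.Injective B2.flip := by
  obtain ⟨P, hP⟩ := exists_isOddPart hsup hinf
  let τ : A ⊗[k] A →ₗ[k] A ⊗[k] A := LinearMap.id - (2 : k) • TensorProduct.map P P
  have hτ : ∀ i j, ∀ a ∈ g i, ∀ b ∈ g j, τ (a ⊗ₜ b) = sg k (i * j) • (a ⊗ₜ b) := by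
    intro i j a ha b hb
    simp only [τ, LinearMap.sub_apply, LinearMap.smul_apply, LinearMap.id_apply,
      TensorProduct.map_tmul, hP i a ha, hP j b hb]
    rcases parity_cases i with rfl | rfl <;> rcases parity_cases j with rfl | rfl <;>
      simp [sg, two_smul]
  have hττ : ∀ t, τ (τ t) = t :=
    homogeneous_induction₂ hsup (fun i j a ha b hb => by
      rw [hτ i j a ha b hb, map_smul, hτ i j a ha b hb, smul_smul, sg_self_mul, one_smul])
      (fun s t hs ht => by rw [map_add, map_add, hs, ht])
  have hdd : ∀ s t, B2 s t = TensorProduct.dualDistrib k A A s (τ t) := fun s =>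
    homogeneous_induction₂ hsup (fun i j a ha b hb => by
      rw [hB2.apply_tmul hD ha hb, hτ i j a ha b hb, map_smul, smul_eq_mul])
      (fun t t' ht ht' => by simp only [map_add, ht, ht'])
  rw [← LinearMap.ker_eq_bot, LinearMap.ker_eq_bot']
  intro t ht
  rw [← hττ t, (Module.forall_dual_apply_eq_zero_iff k (τ t)).1, map_zero]
  intro ξ
  obtain ⟨s, rfl⟩ := (TensorProduct.dualDistribEquiv k A A).surjective ξ
  have := LinearMap.congr_fun ht s
  rw [LinearMap.flip_apply, hdd] at this
  exact this

lemma IsDualPair2.flip_surjective (hB2 : IsDualPair2 k A g B2)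
    (hD : dualGrading k A g 0 ⊔ dualGrading k A g 1 = ⊤)
    (hsup : g 0 ⊔ g 1 = ⊤) (hinf : g 0 ⊓ g 1 = ⊥) : Function.Surjective B2.flip := by
  refine (LinearMap.injective_iff_surjective_of_finrank_eq_finrank ?_).1
    (hB2.flip_injective hD hsup hinf)
  exact (by simp : _ = Module.finrank k (Module.Dual k A ⊗[k] Module.Dual k A)).trans
    (Subspace.dual_finrank_eq (K := k) (V := Module.Dual k A ⊗[k] Module.Dual k A)).symm

lemma IsDualPair2.eq_of_forall_right (hB2 : IsDualPair2 k A g B2)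
    (hD : dualGrading k A g 0 ⊔ dualGrading k A g 1 = ⊤)
    (hsup : g 0 ⊔ g 1 = ⊤) (hinf : g 0 ⊓ g 1 = ⊥)
    {s s' : Module.Dual k A ⊗[k] Module.Dual k A}
    (h : ∀ x y, B2 s (x ⊗ₜ y) = B2 s' (x ⊗ₜ y)) : s = s' := by
  have h' : B2 s = B2 s' := TensorProduct.ext' h
  rw [← sub_eq_zero, ← Module.forall_dual_apply_eq_zero_iff k]
  intro ξ
  obtain ⟨t, rfl⟩ := hB2.flip_surjective hD hsup hinf ξ
  rw [LinearMap.flip_apply, map_sub, h', sub_self, LinearMap.zero_apply]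

lemma IsDualPair2.eq_of_forall_left (hB2 : IsDualPair2 k A g B2)
    (hD : dualGrading k A g 0 ⊔ dualGrading k A g 1 = ⊤)
    (hsup : g 0 ⊔ g 1 = ⊤) (hinf : g 0 ⊓ g 1 = ⊥) {t t' : A ⊗[k] A}
    (h : ∀ φ ψ, B2 (φ ⊗ₜ ψ) t = B2 (φ ⊗ₜ ψ) t') : t = t' :=
  hB2.flip_injective hD hsup hinf (TensorProduct.ext' h)

end Nondegeneracy

section Normalization

variable {k : Type} [Field k] {A : Type} [AddCommGroup A] [Module k A]
variable {mul : A →ₗ[k] A →ₗ[k] A} {one : A} {g : ZMod 2 → Submodule k A}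
  {m2 : (A ⊗[k] A) →ₗ[k] (A ⊗[k] A) →ₗ[k] (A ⊗[k] A)}
  {cop : A →ₗ[k] A ⊗[k] A} {cou : A →ₗ[k] k} {ant : A →ₗ[k] A}
  {B2 : (Module.Dual k A ⊗[k] Module.Dual k A) →ₗ[k] (A ⊗[k] A) →ₗ[k] k}

lemma pairing_tmul_counit (hH : IsHopfSData k A mul one g m2 cop cou ant)
    (hB2 : IsDualPair2 k A g B2) (hsup : dualGrading k A g 0 ⊔ dualGrading k A g 1 = ⊤)
    (φ : Module.Dual k A) (t : A ⊗[k] A) :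
    B2 (φ ⊗ₜ cou) t = φ (TensorProduct.rid k A (TensorProduct.map LinearMap.id cou t)) := by
  refine homogeneous_induction₂ hH.sup_eq (P := fun t => B2 (φ ⊗ₜ cou) t
    = φ (TensorProduct.rid k A (TensorProduct.map LinearMap.id cou t))) ?_ ?_ t
  · intro i j x hx y hy
    rw [hB2.tmul_tmul hsup hx hy]
    rcases parity_cases j with rfl | rfl
    · simp [sg_zero, mul_comm]
    · simp [hH.counit_odd y hy]
  · intro s t hs ht
    simp only [map_add, hs, ht]

lemma pairing_counit_tmul (hH : IsHopfSData k A mul one g m2 cop cou ant)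
    (hB2 : IsDualPair2 k A g B2) (hsup : dualGrading k A g 0 ⊔ dualGrading k A g 1 = ⊤)
    (φ : Module.Dual k A) (t : A ⊗[k] A) :
    B2 (cou ⊗ₜ φ) t = φ (TensorProduct.lid k A (TensorProduct.map cou LinearMap.id t)) := by
  refine homogeneous_induction₂ hH.sup_eq (P := fun t => B2 (cou ⊗ₜ φ) t
    = φ (TensorProduct.lid k A (TensorProduct.map cou LinearMap.id t))) ?_ ?_ t
  · intro i j x hx y hy
    rw [hB2.tmul_tmul hsup hx hy]
    rcases parity_cases i with rfl | rfl
    · simp [sg_zero]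
    · simp [hH.counit_odd x hx]
  · intro s t hs ht
    simp only [map_add, hs, ht]

lemma IsSMul.assoc (hm : IsSMul k A g mul m2)
    (hmem : ∀ {i j : ZMod 2} {x y : A}, x ∈ g i → y ∈ g j → mul x y ∈ g (i + j))
    (hassoc : ∀ x y z, mul (mul x y) z = mul x (mul y z)) (hsup : g 0 ⊔ g 1 = ⊤)
    (s t u : A ⊗[k] A) : m2 (m2 s t) u = m2 s (m2 t u) := by
  revert s t u
  refine homogeneous_induction₂ hsup (P := fun s => ∀ t u, m2 (m2 s t) u = m2 s (m2 t u)) ?_ ?_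
  · intro i j a ha b hb
    refine homogeneous_induction₂ hsup
      (P := fun t => ∀ u, m2 (m2 (a ⊗ₜ b) t) u = m2 (a ⊗ₜ b) (m2 t u)) ?_ ?_
    · intro i' j' a' ha' b' hb'
      refine homogeneous_induction₂ hsup
        (P := fun u => m2 (m2 (a ⊗ₜ b) (a' ⊗ₜ b')) u = m2 (a ⊗ₜ b) (m2 (a' ⊗ₜ b') u)) ?_ ?_
      · intro i'' j'' a'' ha'' b'' hb''
        rw [hm j i' _ _ _ _ hb ha', map_smul, LinearMap.smul_apply,
          hm (j + j') i'' _ _ _ _ (hmem hb hb') ha'', hm j' i'' _ _ _ _ hb' ha'', map_smul,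
          hm j (i' + i'') _ _ _ _ hb (hmem ha' ha''), smul_smul, smul_smul, sg_mul_sg,
          sg_mul_sg, hassoc, hassoc]
        congr 2
        ring
      · intro u v hu hv
        simp only [map_add, hu, hv]
    · intro t t' ht ht' u
      simp only [map_add, LinearMap.add_apply, ht, ht']
  · intro s s' hs hs' t u
    simp only [map_add, LinearMap.add_apply, hs, hs']

lemma IsHopfSData.one_tmul_one_mul (hH : IsHopfSData k A mul one g m2 cop cou ant) (t : A ⊗[k] A) :
    m2 (one ⊗ₜ one) t = t := by
  refine homogeneous_induction₂ hH.sup_eq (P := fun t => m2 (one ⊗ₜ one) t = t) ?_ ?_ t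
  · intro i j a ha b hb
    rw [hH.smul2 0 i _ _ _ _ hH.one_mem ha, zero_mul, sg_zero, one_smul, hH.one_mul, hH.one_mul]
  · intro s t hs ht
    rw [map_add, hs, ht]

lemma IsHopfSData.mul_one_tmul_one (hH : IsHopfSData k A mul one g m2 cop cou ant) (t : A ⊗[k] A) :
    m2 t (one ⊗ₜ one) = t := by
  refine homogeneous_induction₂ hH.sup_eq (P := fun t => m2 t (one ⊗ₜ one) = t) ?_ ?_ t
  · intro i j a ha b hb
    rw [hH.smul2 j 0 _ _ _ _ hb hH.one_mem, mul_zero, sg_zero, one_smul, hH.mul_one, hH.mul_one]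
  · intro s t hs ht
    rw [map_add, LinearMap.add_apply, hs, ht]

lemma IsTwist.eq_inv (hH : IsHopfSData k A mul one g m2 cop cou ant) {f fi : A ⊗[k] A}
    (hf : IsTwist k A mul one g m2 cop cou f fi) {h : A ⊗[k] A}
    (hh : m2 f h = one ⊗ₜ one) : h = fi := by
  rw [← IsHopfSData.one_tmul_one_mul hH h, ← hf.2.1, hH.smul2.assoc hH.mul_mem hH.mul_assoc hH.sup_eq, hh,
    IsHopfSData.mul_one_tmul_one hH]

end Normalization

section Cocycle

variable {k : Type} [Field k] {A : Type} [AddCommGroup A] [Module k A]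
variable {mul : A →ₗ[k] A →ₗ[k] A} {one : A} {g : ZMod 2 → Submodule k A}
  {m2 : (A ⊗[k] A) →ₗ[k] (A ⊗[k] A) →ₗ[k] (A ⊗[k] A)}
  {m3 : ((A ⊗[k] A) ⊗[k] A) →ₗ[k] ((A ⊗[k] A) ⊗[k] A) →ₗ[k] ((A ⊗[k] A) ⊗[k] A)}
  {cop : A →ₗ[k] A ⊗[k] A} {cou : A →ₗ[k] k} {ant : A →ₗ[k] A}
  {B2 : (Module.Dual k A ⊗[k] Module.Dual k A) →ₗ[k] (A ⊗[k] A) →ₗ[k] k}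
  {mulD : Module.Dual k A →ₗ[k] Module.Dual k A →ₗ[k] Module.Dual k A}
  {copD : Module.Dual k A →ₗ[k] Module.Dual k A ⊗[k] Module.Dual k A}

/-- `T` is the Koszul-signed evaluation of `φ ⊗ ψ ⊗ χ` on `(A ⊗ A) ⊗ A`. -/
def IsTripleEval (g : ZMod 2 → Submodule k A) (φ ψ χ : Module.Dual k A)
    (T : (A ⊗[k] A) ⊗[k] A →ₗ[k] k) : Prop :=
  ∀ i j l, ∀ x ∈ g i, ∀ y ∈ g j, ∀ z ∈ g l,
    T ((x ⊗ₜ y) ⊗ₜ z) = sg k (i * j + (i + j) * l) * (φ x * (ψ y * χ z))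

lemma exists_isTripleEval (hsup : g 0 ⊔ g 1 = ⊤) (hinf : g 0 ⊓ g 1 = ⊥)
    (hB2 : IsDualPair2 k A g B2) (hD : dualGrading k A g 0 ⊔ dualGrading k A g 1 = ⊤)
    (φ ψ χ : Module.Dual k A) : ∃ T, IsTripleEval g φ ψ χ T := by
  obtain ⟨P, hP⟩ := exists_isOddPart hsup hinf
  let E : A →ₗ[k] A := LinearMap.id - (2 : k) • P
  have hE : ∀ i, ∀ x ∈ g i, E x = sg k i • x := by
    intro i x hx
    simp only [E, LinearMap.sub_apply, LinearMap.smul_apply, LinearMap.id_apply, hP i x hx]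
    rcases parity_cases i with rfl | rfl <;> simp [sg, two_smul]
  refine ⟨TensorProduct.lift ((LinearMap.mul k k).compl₁₂ (B2 (φ ⊗ₜ ψ))
      (χ ∘ₗ (LinearMap.id - P)))
    + TensorProduct.lift ((LinearMap.mul k k).compl₁₂ (B2 (φ ⊗ₜ ψ) ∘ₗ TensorProduct.map E E)
      (χ ∘ₗ P)), fun i j l x hx y hy z hz => ?_⟩
  simp only [LinearMap.add_apply, TensorProduct.lift.tmul, LinearMap.compl₁₂_apply,
    LinearMap.mul_apply', LinearMap.comp_apply, LinearMap.sub_apply, LinearMap.id_apply,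
    hP l z hz, TensorProduct.map_tmul, hE i x hx, hE j y hy]
  rw [hB2.tmul_tmul hD hx hy,
    hB2.tmul_tmul hD (Submodule.smul_mem _ _ hx) (Submodule.smul_mem _ _ hy)]
  rcases parity_cases l with rfl | rfl
  · simp
    ring
  · simp only [one_ne_zero, if_false, sub_self, map_zero, mul_zero, zero_add, map_smul,
      smul_eq_mul, mul_one, ← sg_mul_sg]
    ring

lemma sum_pairing_mul_pairing_left (hH : IsHopfSData k A mul one g m2 cop cou ant)
    (hm3 : IsSMul3 k A g mul m3) (hB2 : IsDualPair2 k A g B2)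
    (hsup : dualGrading k A g 0 ⊔ dualGrading k A g 1 = ⊤)
    (hcop : ∀ φ x y, B2 (copD φ) (x ⊗ₜ y) = φ (mul x y))
    (hmul : ∀ φ ψ x, mulD φ ψ x = B2 (φ ⊗ₜ ψ) (cop x)) {φ ψ χ : Module.Dual k A}
    {T : (A ⊗[k] A) ⊗[k] A →ₗ[k] k} (hT : IsTripleEval g φ ψ χ T)
    {ι : Type} {s : Finset ι} {a b : ι → Module.Dual k A} {pa pb : ι → ZMod 2}
    (h : Rep k (Module.Dual k A) (dualGrading k A g) (copD φ) ι s a b pa pb)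
    {ι' : Type} {s' : Finset ι'} {c d : ι' → Module.Dual k A} {pc pd : ι' → ZMod 2}
    (h' : Rep k (Module.Dual k A) (dualGrading k A g) (copD ψ) ι' s' c d pc pd)
    {e : A ⊗[k] A} (he : e ∈ evenTensors g) (t : A ⊗[k] A) :
    ∑ i ∈ s, ∑ j ∈ s', sg k (pb i * pc j) *
        (B2 (a i ⊗ₜ c j) e * B2 (mulD (b i) (d j) ⊗ₜ χ) t)
      = T (m3 (e ⊗ₜ one) (TensorProduct.map cop LinearMap.id t)) := by
  refine homogeneous_induction₂ hH.sup_eq (P := fun t => ∑ i ∈ s, ∑ j ∈ s',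
    sg k (pb i * pc j) * (B2 (a i ⊗ₜ c j) e * B2 (mulD (b i) (d j) ⊗ₜ χ) t)
      = T (m3 (e ⊗ₜ one) (TensorProduct.map cop LinearMap.id t))) ?_ ?_ t
  · intro n l r hr w hw
    have key : ∑ i ∈ s, ∑ j ∈ s', sg k (pb i * pc j) *
        (B2 (a i ⊗ₜ c j) e * B2 (mulD (b i) (d j) ⊗ₜ χ) (r ⊗ₜ w))
        = sg k (n * l) * (B2 (φ ⊗ₜ ψ) (m2 e (cop r)) * χ w) := by
      rw [← sum_pairing_mul_pairing hH hB2 hsup hcop h h' he]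
      simp only [Finset.mul_sum, Finset.sum_mul, hB2.tmul_tmul hsup hr hw, hmul]
      exact Finset.sum_congr rfl fun i _ => Finset.sum_congr rfl fun j _ => by ring
    rw [key, TensorProduct.map_tmul, LinearMap.id_apply]
    refine cop_induction hH hr (P := fun v => sg k (n * l) * (B2 (φ ⊗ₜ ψ) (m2 e v) * χ w)
      = T (m3 (e ⊗ₜ one) (v ⊗ₜ w))) ?_ ?_
    · intro n₁ n₂ v₁ hv₁ v₂ hv₂ hn
      refine evenTensors_induction (P := fun e => sg k (n * l) *
        (B2 (φ ⊗ₜ ψ) (m2 e (v₁ ⊗ₜ v₂)) * χ w) = T (m3 (e ⊗ₜ one) ((v₁ ⊗ₜ v₂) ⊗ₜ w))) ?_ ?_ he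
      · intro p q x hx y hy hpq
        rw [hH.smul2 q n₁ _ _ _ _ hy hv₁, map_smul, hB2.tmul_tmul hsup (hH.mul_mem hx hv₁)
          (hH.mul_mem hy hv₂), hm3 q 0 n₁ n₂ _ _ _ _ _ _ hy hH.one_mem hv₁ hv₂, hH.one_mul,
          map_smul, hT _ _ _ _ (hH.mul_mem hx hv₁) _ (hH.mul_mem hy hv₂) _ hw, smul_eq_mul,
          smul_eq_mul, hn, mul_assoc (sg k _), sg_mul_sg_assoc, mul_assoc (sg k _),
          sg_mul_sg_assoc, sg_mul_sg_assoc, mul_assoc (φ _)]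
        congr 1
        rcases hpq with rfl | hsg
        · congr 1
          have aux : ∀ p n₁ n₂ l : ZMod 2, (n₁ + n₂) * l + (p * n₁ + (p + n₁) * (p + n₂))
            = p * n₁ + 0 * n₁ + 0 * n₂ + ((p + n₁) * (p + n₂) + (p + n₁ + (p + n₂)) * l) := by
            decide
          rw [← aux]
          ring
        · rw [hsg, hsg]
      · intro e e' he he'
        simp only [TensorProduct.add_tmul, map_add, LinearMap.add_apply, ← he, ← he']
        ring
    · intro v v' hv hv'
      simp only [TensorProduct.add_tmul, map_add, ← hv, ← hv']
      ring
  · intro t t' ht ht'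
    simp only [map_add, mul_add, Finset.sum_add_distrib, ht, ht']

lemma sum_pairing_mul_pairing_right (hH : IsHopfSData k A mul one g m2 cop cou ant)
    (hm3 : IsSMul3 k A g mul m3) (hB2 : IsDualPair2 k A g B2)
    (hsup : dualGrading k A g 0 ⊔ dualGrading k A g 1 = ⊤)
    (hcop : ∀ φ x y, B2 (copD φ) (x ⊗ₜ y) = φ (mul x y))
    (hmul : ∀ φ ψ x, mulD φ ψ x = B2 (φ ⊗ₜ ψ) (cop x)) {φ ψ χ : Module.Dual k A}
    {T : (A ⊗[k] A) ⊗[k] A →ₗ[k] k} (hT : IsTripleEval g φ ψ χ T)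
    {ι : Type} {s : Finset ι} {a b : ι → Module.Dual k A} {pa pb : ι → ZMod 2}
    (h : Rep k (Module.Dual k A) (dualGrading k A g) (copD ψ) ι s a b pa pb)
    {ι' : Type} {s' : Finset ι'} {c d : ι' → Module.Dual k A} {pc pd : ι' → ZMod 2}
    (h' : Rep k (Module.Dual k A) (dualGrading k A g) (copD χ) ι' s' c d pc pd)
    {e : A ⊗[k] A} (he : e ∈ evenTensors g) (t : A ⊗[k] A) :
    ∑ i ∈ s, ∑ j ∈ s', sg k (pb i * pc j) *
        (B2 (a i ⊗ₜ c j) e * B2 (φ ⊗ₜ mulD (b i) (d j)) t)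
      = T (m3 ((TensorProduct.assoc k A A A).symm (one ⊗ₜ e))
          ((TensorProduct.assoc k A A A).symm (TensorProduct.map LinearMap.id cop t))) := by
  refine homogeneous_induction₂ hH.sup_eq (P := fun t => ∑ i ∈ s, ∑ j ∈ s',
    sg k (pb i * pc j) * (B2 (a i ⊗ₜ c j) e * B2 (φ ⊗ₜ mulD (b i) (d j)) t)
      = T (m3 ((TensorProduct.assoc k A A A).symm (one ⊗ₜ e))
          ((TensorProduct.assoc k A A A).symm (TensorProduct.map LinearMap.id cop t)))) ?_ ?_ t
  · intro n l r hr w hw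
    have key : ∑ i ∈ s, ∑ j ∈ s', sg k (pb i * pc j) *
        (B2 (a i ⊗ₜ c j) e * B2 (φ ⊗ₜ mulD (b i) (d j)) (r ⊗ₜ w))
        = sg k (n * l) * (φ r * B2 (ψ ⊗ₜ χ) (m2 e (cop w))) := by
      rw [← sum_pairing_mul_pairing hH hB2 hsup hcop h h' he]
      simp only [Finset.mul_sum, hB2.tmul_tmul hsup hr hw, hmul]
      exact Finset.sum_congr rfl fun i _ => Finset.sum_congr rfl fun j _ => by ring
    rw [key, TensorProduct.map_tmul, LinearMap.id_apply]
    refine cop_induction hH hw (P := fun v => sg k (n * l) * (φ r * B2 (ψ ⊗ₜ χ) (m2 e v))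
      = T (m3 ((TensorProduct.assoc k A A A).symm (one ⊗ₜ e))
          ((TensorProduct.assoc k A A A).symm (r ⊗ₜ v)))) ?_ ?_
    · intro l₁ l₂ v₁ hv₁ v₂ hv₂ hl
      refine evenTensors_induction (P := fun e => sg k (n * l) *
        (φ r * B2 (ψ ⊗ₜ χ) (m2 e (v₁ ⊗ₜ v₂)))
          = T (m3 ((TensorProduct.assoc k A A A).symm (one ⊗ₜ e))
            ((TensorProduct.assoc k A A A).symm (r ⊗ₜ (v₁ ⊗ₜ v₂))))) ?_ ?_ he
      · intro p q x hx y hy hpq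
        rw [TensorProduct.assoc_symm_tmul, TensorProduct.assoc_symm_tmul,
          hH.smul2 q l₁ _ _ _ _ hy hv₁, map_smul, hB2.tmul_tmul hsup (hH.mul_mem hx hv₁)
          (hH.mul_mem hy hv₂), hm3 p q n l₁ _ _ _ _ _ _ hx hy hr hv₁, hH.one_mul,
          map_smul, hT _ _ _ _ hr _ (hH.mul_mem hx hv₁) _ (hH.mul_mem hy hv₂), smul_eq_mul,
          smul_eq_mul, hl, sg_mul_sg_assoc, sg_mul_sg_assoc, mul_left_comm (φ r),
          sg_mul_sg_assoc]
        congr 1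
        rcases hpq with rfl | hsg
        · congr 1
          have aux : ∀ p n l₁ l₂ : ZMod 2, n * (l₁ + l₂) + (p * l₁ + (p + l₁) * (p + l₂))
            = p * n + p * n + p * l₁ + (n * (p + l₁) + (n + (p + l₁)) * (p + l₂)) := by
            decide
          exact aux p n l₁ l₂
        · rw [hsg, hsg]
      · intro e e' he he'
        simp only [TensorProduct.tmul_add, map_add, LinearMap.add_apply, ← he, ← he']
        ring
    · intro v v' hv hv'
      simp only [TensorProduct.tmul_add, map_add, ← hv, ← hv']
      ring
  · intro t t' ht ht'
    simp only [map_add, mul_add, Finset.sum_add_distrib, ht, ht']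

end Cocycle

section Deformation

variable {k : Type} [Field k] {A : Type} [AddCommGroup A] [Module k A]
variable {mul : A →ₗ[k] A →ₗ[k] A} {one : A} {g : ZMod 2 → Submodule k A}
  {m2 : (A ⊗[k] A) →ₗ[k] (A ⊗[k] A) →ₗ[k] (A ⊗[k] A)}
  {cop : A →ₗ[k] A ⊗[k] A} {cou : A →ₗ[k] k} {ant : A →ₗ[k] A}
  {B2 : (Module.Dual k A ⊗[k] Module.Dual k A) →ₗ[k] (A ⊗[k] A) →ₗ[k] k}
  {copD : Module.Dual k A →ₗ[k] Module.Dual k A ⊗[k] Module.Dual k A}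

lemma sum_pairing_mul_pairing_mul_pairing (hH : IsHopfSData k A mul one g m2 cop cou ant)
    (hB2 : IsDualPair2 k A g B2)
    (hsup : dualGrading k A g 0 ⊔ dualGrading k A g 1 = ⊤)
    (hcop : ∀ φ x y, B2 (copD φ) (x ⊗ₜ y) = φ (mul x y)) {φ ψ : Module.Dual k A}
    {ι : Type} {s : Finset ι} {a b c : ι → Module.Dual k A} {pa pb pc : ι → ZMod 2}
    (h : Rep3 k (Module.Dual k A) (dualGrading k A g) copD φ ι s a b c pa pb pc)
    {ι' : Type} {s' : Finset ι'} {a' b' c' : ι' → Module.Dual k A} {pa' pb' pc' : ι' → ZMod 2}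
    (h' : Rep3 k (Module.Dual k A) (dualGrading k A g) copD ψ ι' s' a' b' c' pa' pb' pc')
    {e t : A ⊗[k] A} (he : e ∈ evenTensors g) (ht : t ∈ evenTensors g) (w : A ⊗[k] A) :
    ∑ i ∈ s, ∑ j ∈ s', (sg k (pa' j * (pb i + pc i) + pb' j * pc i)
        * (B2 (a i ⊗ₜ a' j) e * B2 (c i ⊗ₜ c' j) t)) * B2 (b i ⊗ₜ b' j) w
      = B2 (φ ⊗ₜ ψ) (m2 e (m2 w t)) := by
  refine evenTensors_induction (P := fun e => ∑ i ∈ s, ∑ j ∈ s',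
    (sg k (pa' j * (pb i + pc i) + pb' j * pc i)
        * (B2 (a i ⊗ₜ a' j) e * B2 (c i ⊗ₜ c' j) t)) * B2 (b i ⊗ₜ b' j) w
      = B2 (φ ⊗ₜ ψ) (m2 e (m2 w t))) ?_ ?_ he
  · intro p q x hx y hy hpq
    refine evenTensors_induction (P := fun t => ∑ i ∈ s, ∑ j ∈ s',
      (sg k (pa' j * (pb i + pc i) + pb' j * pc i)
          * (B2 (a i ⊗ₜ a' j) (x ⊗ₜ y) * B2 (c i ⊗ₜ c' j) t)) * B2 (b i ⊗ₜ b' j) w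
        = B2 (φ ⊗ₜ ψ) (m2 (x ⊗ₜ y) (m2 w t))) ?_ ?_ ht
    · intro l l' u hu v hv hll
      refine homogeneous_induction₂ hH.sup_eq (P := fun w => ∑ i ∈ s, ∑ j ∈ s',
        (sg k (pa' j * (pb i + pc i) + pb' j * pc i)
            * (B2 (a i ⊗ₜ a' j) (x ⊗ₜ y) * B2 (c i ⊗ₜ c' j) (u ⊗ₜ v))) * B2 (b i ⊗ₜ b' j) w
          = B2 (φ ⊗ₜ ψ) (m2 (x ⊗ₜ y) (m2 w (u ⊗ₜ v)))) ?_ ?_ w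
      · intro m n r hr r' hr'
        have key : ∀ i ∈ s, ∀ j ∈ s', (sg k (pa' j * (pb i + pc i) + pb' j * pc i)
            * (B2 (a i ⊗ₜ a' j) (x ⊗ₜ y) * B2 (c i ⊗ₜ c' j) (u ⊗ₜ v)))
              * B2 (b i ⊗ₜ b' j) (r ⊗ₜ r')
            = sg k (q * (m + l) + n * l + p * q + l * l' + m * n)
              * ((a i x * b i r * c i u) * (a' j y * b' j r' * c' j v)) := by
          intro i hi j hj
          rw [hB2.tmul_tmul hsup hx hy, hB2.tmul_tmul hsup hu hv, hB2.tmul_tmul hsup hr hr']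
          rcases dualGrading_eq_or_apply_eq_zero (h.2 i hi).2.1 hr with h₁ | h₁
          · rcases dualGrading_eq_or_apply_eq_zero (h.2 i hi).2.2 hu with h₂ | h₂
            · rcases dualGrading_eq_or_apply_eq_zero (h'.2 j hj).1 hy with h₃ | h₃
              · rcases dualGrading_eq_or_apply_eq_zero (h'.2 j hj).2.1 hr' with h₄ | h₄
                · rw [h₁, h₂, h₃, h₄, ← sg_mul_sg, ← sg_mul_sg, ← sg_mul_sg, ← sg_mul_sg, ← sg_mul_sg]
                  ring
                · simp [h₄]
              · simp [h₃]
            · simp [h₂]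
          · simp [h₁]
        rw [Finset.sum_congr rfl fun i hi => Finset.sum_congr rfl fun j hj => key i hi j hj]
        simp only [← Finset.mul_sum]
        rw [← Finset.sum_mul, h.sum_apply_mul_apply hH hB2 hsup hcop hx hr hu,
          h'.sum_apply_mul_apply hH hB2 hsup hcop hy hr' hv, hH.smul2 n l _ _ _ _ hr' hu,
          map_smul, hH.smul2 q (m + l) _ _ _ _ hy (hH.mul_mem hr hu), smul_smul, sg_mul_sg,
          map_smul, hB2.tmul_tmul hsup (hH.mul_mem hx (hH.mul_mem hr hu))
          (hH.mul_mem hy (hH.mul_mem hr' hv)), smul_eq_mul, sg_mul_sg_assoc, mul_mul_mul_comm,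
          sg_mul_sg, sg_mul_sg_assoc, hH.mul_assoc, hH.mul_assoc]
        congr 1
        rcases hpq with rfl | hsg
        · rcases hll with rfl | hsg
          · congr 1
            have aux : ∀ p l m n : ZMod 2, p * (m + l) + n * l + p * p + l * l + m * n
                + (p * m + (p + m) * l + (p * n + (p + n) * l))
                = n * l + p * (m + l) + (p + (m + l)) * (p + (n + l)) := by decide
            exact aux p l m n
          · rw [hsg, hsg]
        · rw [hsg, hsg]
      · intro w w' hw hw'
        simp only [map_add, LinearMap.add_apply, ← hw, ← hw', ← Finset.sum_add_distrib]
        exact Finset.sum_congr rfl fun _ _ => Finset.sum_congr rfl fun _ _ => by ring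
    · intro t t' ht ht'
      simp only [map_add, ← ht, ← ht', ← Finset.sum_add_distrib]
      exact Finset.sum_congr rfl fun _ _ => Finset.sum_congr rfl fun _ _ => by ring
  · intro e e' he he'
    simp only [map_add, LinearMap.add_apply, ← he, ← he', ← Finset.sum_add_distrib]
    exact Finset.sum_congr rfl fun _ _ => Finset.sum_congr rfl fun _ _ => by ring

end Deformation

/-- Proposition 3.9(a).  Let `H` be a (finite-dimensional) Hopf
superalgebra over `k` and `H^* = Module.Dual k A` its linear dual, with its dual
Hopf superalgebra structure.  Let `F` be a twist for `H` and let `σ_F` be the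
image of `F` in `(H^* ⊗ H^*)^*`, i.e. the bilinear form
`σ_F(φ,ψ) = ⟨φ ⊗ ψ, F⟩` (Koszul-signed evaluation).  Then `σ_F` is a 2-cocycle
for `H^*`, and there is a canonical isomorphism `(H^*)_{σ_F} ≅ (H^F)^*`:  for
any 2-cocycle deformation `mulσ` of the product of `H^*` by `σ_F`, and any dual
Hopf structure of the twist deformation `H^F`, the two are isomorphic. -/
theorem statement6 (k : Type) [Field k]
    (A : Type) [AddCommGroup A] [Module k A] [FiniteDimensional k A]
    (mul : A →ₗ[k] A →ₗ[k] A) (one : A) (g : ZMod 2 → Submodule k A)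
    (m2 : (A ⊗[k] A) →ₗ[k] (A ⊗[k] A) →ₗ[k] (A ⊗[k] A))
    (cop : A →ₗ[k] A ⊗[k] A) (cou : A →ₗ[k] k) (ant : A →ₗ[k] A)
    (hH : IsHopfSData k A mul one g m2 cop cou ant)
    -- a twist `F` for `H`, with inverse `fi`:
    (f fi : A ⊗[k] A) (hf : IsTwist k A mul one g m2 cop cou f fi)
    -- the dual Hopf superalgebra `H^*`:
    (mulD : Module.Dual k A →ₗ[k] Module.Dual k A →ₗ[k] Module.Dual k A)
    (oneD : Module.Dual k A) (gD : ZMod 2 → Submodule k (Module.Dual k A))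
    (m2D : (Module.Dual k A ⊗[k] Module.Dual k A) →ₗ[k]
      (Module.Dual k A ⊗[k] Module.Dual k A) →ₗ[k]
      (Module.Dual k A ⊗[k] Module.Dual k A))
    (copD : Module.Dual k A →ₗ[k] Module.Dual k A ⊗[k] Module.Dual k A)
    (couD : Module.Dual k A →ₗ[k] k)
    (antD : Module.Dual k A →ₗ[k] Module.Dual k A)
    (hD : IsHopfSData k (Module.Dual k A) mulD oneD gD m2D copD couD antD)
    (hdual : IsDualHopfOf k A (fun x y => mul x y) one g cop cou ant
      (fun φ ψ => mulD φ ψ) oneD gD copD couD antD)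
    -- the Koszul-signed evaluation pairing:
    (B2 : (Module.Dual k A ⊗[k] Module.Dual k A) →ₗ[k] (A ⊗[k] A) →ₗ[k] k)
    (hB2 : IsDualPair2 k A g B2)
    -- `σ_F` is the image of `F` under the natural embedding
    -- `H ⊗ H ↪ H^{**} ⊗ H^{**} ↪ (H^* ⊗ H^*)^*`:
    (σF : Module.Dual k A →ₗ[k] Module.Dual k A →ₗ[k] k)
    (hσF : ∀ φ ψ : Module.Dual k A, σF φ ψ = B2 (φ ⊗ₜ[k] ψ) f) :
    -- (1) `σ_F` is a 2-cocycle for `H^*`: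
    Is2Cocycle k (Module.Dual k A) gD (fun φ ψ => mulD φ ψ) oneD copD couD σF ∧
    -- (2) there is a canonical isomorphism `(H^*)_{σ_F} ≅ (H^F)^*`:
    (∀ σi : Module.Dual k A →ₗ[k] Module.Dual k A →ₗ[k] k,
      ConvInverse k (Module.Dual k A) gD copD couD σF σi →
      ∀ mulσ : Module.Dual k A → Module.Dual k A → Module.Dual k A,
        IsCocycleDeform k (Module.Dual k A) gD (fun φ ψ => mulD φ ψ) copD σF σi mulσ →
        ∀ copF : A →ₗ[k] A ⊗[k] A, (∀ x : A, copF x = m2 f (m2 (cop x) fi)) →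
        ∀ antF : A →ₗ[k] A, IsHopfSData k A mul one g m2 copF cou antF →
        ∀ (mulDF : Module.Dual k A → Module.Dual k A → Module.Dual k A)
          (oneDF : Module.Dual k A) (gDF : ZMod 2 → Submodule k (Module.Dual k A))
          (copDF : Module.Dual k A →ₗ[k] Module.Dual k A ⊗[k] Module.Dual k A)
          (couDF : Module.Dual k A →ₗ[k] k)
          (antDF : Module.Dual k A →ₗ[k] Module.Dual k A),
          IsDualHopfOf k A (fun x y => mul x y) one g copF cou antF
            mulDF oneDF gDF copDF couDF antDF →
          ∃ e : Module.Dual k A ≃ₗ[k] Module.Dual k A,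
            (∀ φ ψ : Module.Dual k A, e (mulσ φ ψ) = mulDF (e φ) (e ψ)) ∧
            e oneD = oneDF ∧
            (∀ φ : Module.Dual k A,
              (TensorProduct.map e.toLinearMap e.toLinearMap) (copD φ) = copDF (e φ)) ∧
            (∀ φ : Module.Dual k A, couDF (e φ) = couD φ)) := by
  obtain rfl : gD = dualGrading k A g := hdual.grading_eq
  obtain rfl : oneD = cou := hdual.one_eq
  have hsup := hD.sup_eq
  have hcop := hdual.comul_eq B2 hB2
  have hmul := hdual.mul_eq B2 hB2
  have hfe := hf.mem_evenTensors hH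
  have hfie := hf.inv_mem_evenTensors hH
  have hone : ∀ φ ψ, B2 (φ ⊗ₜ ψ) (one ⊗ₜ one) = couD φ * couD ψ := fun φ ψ => by
    rw [hB2.tmul_tmul hsup hH.one_mem hH.one_mem, mul_zero, sg_zero, one_mul,
      hdual.counit_eq, hdual.counit_eq]
  refine ⟨⟨fun φ => ?_, fun φ => ?_, ?_, ?_⟩, ?_⟩
  · rw [hσF, pairing_tmul_counit hH hB2 hsup, hf.2.2.2.1, hdual.counit_eq]
  · rw [hσF, pairing_counit_tmul hH hB2 hsup, hf.2.2.1, hdual.counit_eq]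
  · refine ⟨(TensorProduct.mk k _ _).compr₂ (B2.flip fi), ?_⟩
    intro φ ψ ι s a b pa pb h ι' s' c d pc pd h'
    simp only [hσF, LinearMap.compr₂_apply, TensorProduct.mk_apply, LinearMap.flip_apply]
    exact ⟨by rw [sum_pairing_mul_pairing hH hB2 hsup hcop h h' hfe, hf.1, hone],
      by rw [sum_pairing_mul_pairing hH hB2 hsup hcop h h' hfie, hf.2.1, hone]⟩
  · intro φ ψ χ ι s a b pa pb h ι' s' c d pc pd h' ι'' s'' u v pu pv h''
    obtain ⟨m3, hm3⟩ := exists_isSMul3 hH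
    obtain ⟨T, hT⟩ := exists_isTripleEval hH.sup_eq hH.inf_eq hB2 hsup φ ψ χ
    simp only [hσF]
    rw [sum_pairing_mul_pairing_left hH hm3 hB2 hsup hcop hmul hT h h' hfe,
      sum_pairing_mul_pairing_right hH hm3 hB2 hsup hcop hmul hT h' h'' hfe,
      hf.2.2.2.2 m3 hm3]
  · intro σi hσi mulσ hmulσ copF hcopF antF _ mulDF oneDF gDF copDF couDF antDF hDF
    obtain ⟨t, ht⟩ := hB2.flip_surjective hsup hH.sup_eq hH.inf_eq (TensorProduct.lift σi)
    have hσt : ∀ φ ψ, σi φ ψ = B2 (φ ⊗ₜ ψ) t := fun φ ψ => by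
      rw [← TensorProduct.lift.tmul, ← ht, LinearMap.flip_apply]
    obtain rfl : t = fi := by
      refine hf.eq_inv hH (hB2.eq_of_forall_left hsup hH.sup_eq hH.inf_eq fun φ ψ => ?_)
      obtain ⟨ι, s, a, b, pa, pb, h⟩ := exists_rep hsup (copD φ)
      obtain ⟨ι', s', c, d, pc, pd, h'⟩ := exists_rep hsup (copD ψ)
      rw [← sum_pairing_mul_pairing hH hB2 hsup hcop h h' hfe, hone,
        ← (hσi φ ψ ι s a b pa pb h ι' s' c d pc pd h').1]
      simp only [hσF, hσt]
    refine ⟨LinearEquiv.refl k _, fun φ ψ => ?_, hDF.one_eq.symm, fun φ => ?_, fun φ => ?_⟩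
    · obtain ⟨ι, s, a, b, c, pa, pb, pc, h⟩ := exists_rep₃ hsup copD φ
      obtain ⟨ι', s', a', b', c', pa', pb', pc', h'⟩ := exists_rep₃ hsup copD ψ
      ext x
      rw [LinearEquiv.refl_apply, LinearEquiv.refl_apply, LinearEquiv.refl_apply,
        hDF.mul_eq B2 hB2, hcopF,
        ← sum_pairing_mul_pairing_mul_pairing hH hB2 hsup hcop h h' hfe hfie,
        hmulσ φ ψ ι s a b c pa pb pc h ι' s' a' b' c' pa' pb' pc' h']
      simp only [LinearMap.sum_apply, LinearMap.smul_apply, smul_eq_mul, hσF, hσt, hmul]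
    · refine hB2.eq_of_forall_right hsup hH.sup_eq hH.inf_eq fun x y => ?_
      rw [LinearEquiv.refl_apply, hDF.comul_eq B2 hB2, LinearEquiv.refl_toLinearMap,
        TensorProduct.map_id, LinearMap.id_apply, hcop]
    · rw [LinearEquiv.refl_apply, hDF.counit_eq, hdual.counit_eq]

end QGLS
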